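/- Let G be a second countable locally compact Hausdorff Abelian group bundle over X with Haar system {β^x}. For a sequence (s_n) in G and a point s_0 ∈ G, the following are equivalent: (i) s_n → s_0 in the topology of G; (ii) p(s_n) → p(s_0) in X, and for every sequence of characters ω_n of the fibre G_{p(s_n)} (n ≥ 1) and every character ω_0 of G_{p(s_0)} such that the sequence (p(s_n), ω_n) converges to (p(s_0), ω_0) in the character-convergence sense, one has ω_n(s_n) → ω_0(s_0) in the circle group. (This is the sequential form of the paper's main theorem that the evaluation map Φ : G → Ĝ̂, Φ(s)(ω) = ω(s), is a topological group bundle isomorphism onto the double dual bundle, combined with the sequential characterization of the dual topology.) -/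

import Mathlib

open Filter Topology MeasureTheory

/-- An Abelian group bundle: topological spaces `G` and `X`, a continuous surjection
`p : G → X`, a continuous multiplication on the fibre product, a continuous unit section
and a continuous inversion, making each fibre `p⁻¹(x)` an Abelian group. -/
structure AbelianGroupBundle (G X : Type*) [TopologicalSpace G] [TopologicalSpace X] where
  p : G → X
  continuous_p : Continuous p
  surjective_p : Function.Surjective p
  mul : (s t : G) → p s = p t → G
  continuous_mul :
    Continuous fun q : {q : G × G // p q.1 = p q.2} => mul q.1.1 q.1.2 q.2
  p_mul : ∀ s t (h : p s = p t), p (mul s t h) = p s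
  unit : X → G
  continuous_unit : Continuous unit
  p_unit : ∀ x, p (unit x) = x
  inv : G → G
  continuous_inv : Continuous inv
  p_inv : ∀ s, p (inv s) = p s
  mul_assoc : ∀ s t r (h₁ : p s = p t) (h₂ : p t = p r),
    mul (mul s t h₁) r (by rw [p_mul]; exact h₁.trans h₂) =
      mul s (mul t r h₂) (by rw [p_mul]; exact h₁)
  mul_comm : ∀ s t (h : p s = p t), mul s t h = mul t s h.symm
  unit_mul : ∀ s, mul (unit (p s)) s (p_unit (p s)) = s
  inv_mul : ∀ s, mul (inv s) s (p_inv s) = unit (p s)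

/-- A character of the fibre `G_x`: a continuous function into the circle group
(complex numbers of modulus one) that is multiplicative on the fibre. -/
structure IsCharacter {G X : Type*} [TopologicalSpace G] [TopologicalSpace X]
    (B : AbelianGroupBundle G X) (x : X) (ω : {s : G // B.p s = x} → ℂ) : Prop where
  norm_one : ∀ s, ‖ω s‖ = 1
  continuous_toFun : Continuous ω
  map_mul : ∀ s t : {s : G // B.p s = x},
    ω ⟨B.mul s.1 t.1 (s.2.trans t.2.symm),
        (B.p_mul s.1 t.1 (s.2.trans t.2.symm)).trans s.2⟩ = ω s * ω t

/-- Character convergence: `(x n, ω n) → (x₀, ω₀)` iff `x n → x₀` in `X` and whenever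
`s n ∈ G_{x n}` with `s n → s₀ ∈ G_{x₀}` in `G`, then `ω n (s n) → ω₀ s₀`. -/
def CharTendsto {G X : Type*} [TopologicalSpace G] [TopologicalSpace X]
    (B : AbelianGroupBundle G X) (x : ℕ → X)
    (ω : ∀ n, {s : G // B.p s = x n} → ℂ)
    (x₀ : X) (ω₀ : {s : G // B.p s = x₀} → ℂ) : Prop :=
  Tendsto x atTop (𝓝 x₀) ∧
    ∀ (s : ℕ → G) (s₀ : G) (hs : ∀ n, B.p (s n) = x n) (hs₀ : B.p s₀ = x₀),
      Tendsto s atTop (𝓝 s₀) →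
        Tendsto (fun n => ω n ⟨s n, hs n⟩) atTop (𝓝 (ω₀ ⟨s₀, hs₀⟩))

/-- A Haar system for an Abelian group bundle: a family of nonzero regular measures,
each supported on the corresponding fibre and invariant under translation by elements of
that fibre, such that integration of a compactly supported continuous function is
continuous in the base point. -/
structure IsHaarSystem {G X : Type*} [TopologicalSpace G] [TopologicalSpace X]
    [MeasurableSpace G] (B : AbelianGroupBundle G X) (β : X → Measure G) : Prop where
  ne_zero : ∀ x, β x ≠ 0
  regular : ∀ x, (β x).Regular
  supported : ∀ x, β x {s | B.p s ≠ x} = 0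
  invariant : ∀ (x : X) (s : G), B.p s = x →
    Measure.map
      (fun t => open scoped Classical in
        if h : B.p s = B.p t then B.mul s t h else t) (β x) = β x
  continuous_integral : ∀ f : G → ℂ, Continuous f → HasCompactSupport f →
    Continuous fun x => ∫ t, f t ∂(β x)


open Filter Topology MeasureTheory

theorem exists_char_of_commute {𝓐 Γ : Type*} [CStarAlgebra 𝓐] [Nontrivial 𝓐] [CommGroup Γ]
    (U : Γ →* 𝓐) (hU : ∀ t, star (U t) = U t⁻¹) (C : 𝓐)
    (hC : ∀ t, U t * C = C * U t) (hC' : star C * C = C * star C) (a : MonoidAlgebra ℂ Γ) :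
    ∃ (ω : Γ →* ℂ) (κ : ℝ), 0 ≤ κ ∧ (∀ t, ‖ω t‖ = 1) ∧
      ‖MonoidAlgebra.lift ℂ 𝓐 Γ U a * C‖ = ‖MonoidAlgebra.lift ℂ ℂ Γ ω a‖ * κ ∧
      ∀ b, ‖MonoidAlgebra.lift ℂ ℂ Γ ω b‖ * κ ≤ ‖MonoidAlgebra.lift ℂ 𝓐 Γ U b * C‖ := by
  classical
  set S : Set 𝓐 := Set.range U ∪ {C, star C} with hS
  have hC2 : ∀ t, U t * star C = star C * U t := by
    intro t
    have := congrArg star (hC t⁻¹)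
    rw [star_mul, star_mul, hU, inv_inv] at this
    exact this.symm
  have hcomm : ∀ x ∈ S, ∀ y ∈ S, x * y = y * x := by
    rintro x (⟨t, rfl⟩ | rfl | rfl) y (⟨r, rfl⟩ | rfl | rfl)
    · rw [← map_mul, mul_comm, map_mul]
    · exact hC t
    · exact hC2 t
    · exact (hC r).symm
    · rfl
    · exact hC'.symm
    · exact (hC2 r).symm
    · exact hC'
    · rfl
  have hstar : ∀ x ∈ S, star x ∈ S := by
    rintro x (⟨t, rfl⟩ | rfl | rfl)
    · left; exact ⟨t⁻¹, (hU t).symm⟩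
    · right; right; rfl
    · right; left; simp
  let A : Subalgebra ℂ 𝓐 := Subalgebra.centralizer ℂ (Subalgebra.centralizer ℂ S : Set 𝓐)
  have hSA : ∀ x ∈ S, x ∈ A := fun x hx => by
    rw [Subalgebra.mem_centralizer_iff]
    intro g hg
    exact ((Subalgebra.mem_centralizer_iff ℂ).1 hg x hx).symm
  have hA : ∀ x ∈ A, ∀ y ∈ A, x * y = y * x := by
    intro x hx y hy
    refine (Subalgebra.mem_centralizer_iff ℂ).1 hy x ?_
    refine (Subalgebra.mem_centralizer_iff ℂ).2 fun g hg => ?_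
    refine (Subalgebra.mem_centralizer_iff ℂ).1 hx g ?_
    exact (Subalgebra.mem_centralizer_iff ℂ).2 fun g' hg' => hcomm g' hg' g hg
  have hAs : ∀ x ∈ A, star x ∈ A := by
    intro x hx
    refine (Subalgebra.mem_centralizer_iff ℂ).2 fun g hg => ?_
    have h1 : star g ∈ Subalgebra.centralizer ℂ S := by
      refine (Subalgebra.mem_centralizer_iff ℂ).2 fun g' hg' => ?_
      have := congrArg star ((Subalgebra.mem_centralizer_iff ℂ).1 hg (star g') (hstar _ hg'))
      simpa using this.symm
    have := congrArg star ((Subalgebra.mem_centralizer_iff ℂ).1 hx (star g) h1)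
    simpa using this.symm
  have hclosed : IsClosed (A : Set 𝓐) := by
    have : (A : Set 𝓐) = ⋂ g ∈ (Subalgebra.centralizer ℂ S : Set 𝓐), {z | g * z = z * g} := by
      ext z
      simp only [Set.mem_iInter, Set.mem_ofPred_eq]
      exact Subalgebra.mem_centralizer_iff ℂ
    rw [this]
    exact isClosed_biInter fun g _ => isClosed_eq (by fun_prop) (by fun_prop)
  have : CompleteSpace A := hclosed.completeSpace_coe
  let : NormedCommRing A :=
    { (inferInstance : NormedRing A) with
      mul_comm := fun x y => Subtype.ext (hA x x.2 y y.2) }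
  let U' : Γ →* A :=
    { toFun := fun t => ⟨U t, hSA _ (Or.inl ⟨t, rfl⟩)⟩
      map_one' := by ext; simp
      map_mul' := fun x y => by ext; simp }
  let C' : A := ⟨C, hSA _ (Or.inr (Or.inl rfl))⟩
  have hlift : ∀ b, ((MonoidAlgebra.lift ℂ A Γ U' b : A) : 𝓐) = MonoidAlgebra.lift ℂ 𝓐 Γ U b := by
    intro b
    have : A.val.comp (MonoidAlgebra.lift ℂ A Γ U') = MonoidAlgebra.lift ℂ 𝓐 Γ U := by
      ext t; simp [U']
    exact DFunLike.congr_fun this b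
  let T : A := MonoidAlgebra.lift ℂ A Γ U' a * C'
  have hT : (T : 𝓐) = MonoidAlgebra.lift ℂ 𝓐 Γ U a * C := by simp [T, hlift, C']
  have : IsStarNormal (T : 𝓐) := ⟨hA _ (hAs _ T.2) _ T.2⟩
  obtain ⟨z, hz, hz'⟩ := spectrum.exists_nnnorm_eq_spectralRadius (T : 𝓐)
  rw [IsStarNormal.spectralRadius_eq_nnnorm] at hz'
  have hz2 : z ∈ spectrum ℂ T := spectrum.subset_subalgebra (R := ℂ) T hz
  obtain ⟨χ, hχ⟩ := WeakDual.CharacterSpace.mem_spectrum_iff_exists.1 hz2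
  have : NormOneClass A := ⟨(CStarRing.norm_one : ‖(1 : 𝓐)‖ = 1)⟩
  have hχle : ∀ x : A, ‖χ x‖ ≤ ‖x‖ := fun x => by
    have := spectrum.norm_le_norm_of_mem (WeakDual.CharacterSpace.mem_spectrum_iff_exists.2 ⟨χ, rfl⟩ : χ x ∈ spectrum ℂ x)
    exact this
  let χ' : A →ₐ[ℂ] ℂ := WeakDual.CharacterSpace.toAlgHom χ
  let ω : Γ →* ℂ := (χ' : A →* ℂ).comp U'
  have hω : ∀ b, MonoidAlgebra.lift ℂ ℂ Γ ω b = χ' (MonoidAlgebra.lift ℂ A Γ U' b) := by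
    intro b
    have : χ'.comp (MonoidAlgebra.lift ℂ A Γ U') = MonoidAlgebra.lift ℂ ℂ Γ ω := by
      ext t; simp [ω]
    exact (DFunLike.congr_fun this b).symm
  have hUn : ∀ t, ‖U t‖ = 1 := fun t => by
    apply CStarRing.norm_of_mem_unitary
    rw [Unitary.mem_iff, hU]
    simp [← map_mul]
  have hle1 : ∀ t, ‖ω t‖ ≤ 1 := fun t => by
    refine (hχle (U' t)).trans ?_
    exact (hUn t).le
  refine ⟨ω, ‖χ' C'‖, norm_nonneg _, fun t => ?_, ?_, fun b => ?_⟩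
  · refine le_antisymm (hle1 t) ?_
    have h1 : ‖ω t‖ * ‖ω t⁻¹‖ = 1 := by rw [← norm_mul, ← map_mul]; simp
    nlinarith [hle1 t, hle1 t⁻¹, norm_nonneg (ω t), norm_nonneg (ω t⁻¹)]
  · rw [hω, ← norm_mul, ← map_mul, ← hT]
    have : χ' T = z := hχ
    rw [show χ' (MonoidAlgebra.lift ℂ A Γ U' a * C') = z from this]
    have := ENNReal.coe_injective hz'
    exact (congrArg NNReal.toReal this).symm
  · rw [hω, ← norm_mul, ← map_mul]
    refine (hχle _).trans ?_
    rw [← hlift]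
    rfl

open Filter Topology MeasureTheory
set_option linter.unusedSectionVars false

lemma inner_toLp {Γ : Type*} [MeasurableSpace Γ] (m : Measure Γ) {f g : Γ → ℂ} (hf : MemLp f 2 m) (hg : MemLp g 2 m) :
    inner ℂ (hf.toLp f) (hg.toLp g) = ∫ s, g s * (starRingEnd ℂ) (f s) ∂m := by
  rw [L2.inner_def]
  refine integral_congr_ae ?_
  filter_upwards [hf.coeFn_toLp, hg.coeFn_toLp] with s h1 h2
  rw [h1, h2]; rfl

section group
variable {Γ : Type*} [CommGroup Γ] [TopologicalSpace Γ] [IsTopologicalGroup Γ]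
  [LocallyCompactSpace Γ] [T2Space Γ] [SecondCountableTopology Γ] [MeasurableSpace Γ] [BorelSpace Γ]
  (m : Measure Γ) [m.IsMulLeftInvariant] [m.Regular]

/-- translation operators on `L²`: `(U t ξ)(s) = ξ (t s)`. -/
noncomputable def transl : Γ →* (Lp ℂ 2 m →L[ℂ] Lp ℂ 2 m) where
  toFun t := LinearMap.mkContinuous
    { toFun := fun ξ => DomMulAct.mk t • ξ
      map_add' := fun x y => smul_add _ x y
      map_smul' := fun c x => (smul_comm _ c x) } 1
    (fun ξ => by simp [DomMulAct.norm_smul_Lp])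
  map_one' := by ext1 ξ; simp
  map_mul' a b := by
    ext1 ξ
    rw [mul_comm]
    simp [mul_smul]

lemma transl_apply (t : Γ) (ξ : Lp ℂ 2 m) : transl m t ξ = DomMulAct.mk t • ξ := rfl

lemma norm_transl_apply (t : Γ) (ξ : Lp ℂ 2 m) : ‖transl m t ξ‖ = ‖ξ‖ := by
  rw [transl_apply, DomMulAct.norm_smul_Lp]

lemma transl_toLp (t : Γ) {f : Γ → ℂ} (hf : MemLp f 2 m) :
    transl m t (hf.toLp f) = (hf.comp_measurePreserving (measurePreserving_mul_left m t)).toLp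
      (fun s => f (t * s)) := by
  rw [transl_apply, DomMulAct.mk_smul_toLp]
  rfl

lemma continuous_transl (ξ : Lp ℂ 2 m) : Continuous fun t => transl m t ξ := by
  simp only [transl_apply]
  have : Fact ((2 : ENNReal) ≠ ⊤) := ⟨by simp⟩
  exact (DomMulAct.continuous_mk).smul continuous_const

lemma star_transl (t : Γ) : star (transl m t) = transl m t⁻¹ := by
  rw [ContinuousLinearMap.star_eq_adjoint, eq_comm, ContinuousLinearMap.eq_adjoint_iff]
  intro x y
  have h : ∀ a b, inner ℂ (transl m t a) (transl m t b) = inner ℂ a b := by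
    let L : Lp ℂ 2 m →ₗᵢ[ℂ] Lp ℂ 2 m := ⟨(transl m t).toLinearMap, norm_transl_apply m t⟩
    exact fun a b => L.inner_map_map a b
  rw [← h]
  congr 1
  rw [← mul_apply_eq_comp, ← map_mul]
  simp

lemma integrable_conv {h : Γ → ℂ} (hc : Continuous h) (hs : HasCompactSupport h) (ξ : Lp ℂ 2 m) :
    Integrable (fun s => h s • transl m s ξ) m :=
  Continuous.integrable_of_hasCompactSupport (hc.smul (continuous_transl m ξ)) hs.smul_right

/-- convolution operators -/
noncomputable def conv (h : Γ → ℂ) (hc : Continuous h) (hs : HasCompactSupport h) :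
    Lp ℂ 2 m →L[ℂ] Lp ℂ 2 m :=
  LinearMap.mkContinuous
    { toFun := fun ξ => ∫ s, h s • transl m s ξ ∂m
      map_add' := fun x y => by
        simp only [map_add, smul_add]
        exact integral_add (integrable_conv m hc hs x) (integrable_conv m hc hs y)
      map_smul' := fun c x => by
        simp only [map_smul, RingHom.id_apply]
        rw [← integral_smul]
        congr 1; ext1 s; rw [smul_comm] } (∫ s, ‖h s‖ ∂m)
    (fun ξ => by
      refine (norm_integral_le_integral_norm _).trans (le_of_eq ?_)
      simp only [norm_smul, norm_transl_apply]
      exact integral_mul_const _ _)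

variable {h : Γ → ℂ} (hc : Continuous h) (hs : HasCompactSupport h)

lemma conv_apply (ξ : Lp ℂ 2 m) : conv m h hc hs ξ = ∫ s, h s • transl m s ξ ∂m := rfl

lemma norm_conv_le : ‖conv m h hc hs‖ ≤ ∫ s, ‖h s‖ ∂m :=
  LinearMap.mkContinuous_norm_le _ (integral_nonneg fun _ => norm_nonneg _) _

lemma conv_commute (T : Lp ℂ 2 m →L[ℂ] Lp ℂ 2 m) (hT : ∀ t, transl m t * T = T * transl m t) :
    T * conv m h hc hs = conv m h hc hs * T := by
  ext1 ξ
  rw [mul_apply_eq_comp, mul_apply_eq_comp, conv_apply, conv_apply,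
    ← ContinuousLinearMap.integral_comp_comm _ (integrable_conv m hc hs ξ)]
  congr 1; ext1 s
  rw [map_smul]
  congr 1
  exact (DFunLike.congr_fun (hT s) ξ).symm

lemma transl_conv (t : Γ) : transl m t * conv m h hc hs = conv m h hc hs * transl m t := by
  apply conv_commute
  intro s
  rw [← map_mul, mul_comm, map_mul]

lemma star_conv : star (conv m h hc hs) * conv m h hc hs = conv m h hc hs * star (conv m h hc hs) := by
  apply conv_commute
  intro t
  have := congrArg star (transl_conv m hc hs t⁻¹)
  rw [star_mul, star_mul, star_transl, inv_inv] at this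
  exact this.symm

lemma inner_conv (T : Lp ℂ 2 m →L[ℂ] Lp ℂ 2 m) (ξ η : Lp ℂ 2 m) :
    inner ℂ η (T (conv m h hc hs ξ)) = ∫ s, h s * inner ℂ η (T (transl m s ξ)) ∂m := by
  rw [conv_apply, ← ContinuousLinearMap.integral_comp_comm _ (integrable_conv m hc hs ξ),
    ← integral_inner (T.integrable_comp (integrable_conv m hc hs ξ))]
  congr 1; ext1 s
  rw [map_smul, inner_smul_right]

lemma norm_transl_conv_sub (t : Γ) :
    ‖transl m t * conv m h hc hs - conv m h hc hs‖ ≤ ∫ s, ‖h (t⁻¹ * s) - h s‖ ∂m := by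
  have hc' : Continuous fun s => h (t⁻¹ * s) := hc.comp (continuous_const.mul continuous_id)
  have hs' : HasCompactSupport fun s => h (t⁻¹ * s) :=
    hs.comp_homeomorph (Homeomorph.mulLeft t⁻¹)
  have h1 : transl m t * conv m h hc hs - conv m h hc hs =
      conv m (fun s => h (t⁻¹ * s) - h s) (hc'.sub hc) (hs'.sub hs) := by
    ext1 ξ
    rw [sub_apply, mul_apply_eq_comp, conv_apply, conv_apply,
      ← ContinuousLinearMap.integral_comp_comm _ (integrable_conv m hc hs ξ)]
    simp only [sub_smul]
    rw [integral_sub (integrable_conv m hc' hs' ξ) (integrable_conv m hc hs ξ)]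
    congr 1
    rw [← integral_mul_left_eq_self (fun s => h (t⁻¹ * s) • transl m s ξ) t]
    congr 1; ext1 s
    rw [map_smul, inv_mul_cancel_left, map_mul, mul_apply_eq_comp]
  rw [h1]
  exact norm_conv_le _ _ _

/-- If `T ≠ 0` then `T * C_h ≠ 0` for any bump function near the identity. -/
lemma exists_mul_conv_ne [m.IsOpenPosMeasure] (T : Lp ℂ 2 m →L[ℂ] Lp ℂ 2 m) (hT : T ≠ 0) :
    ∃ O ∈ 𝓝 (1 : Γ), ∀ (k : Γ → ℝ) (hk : Continuous fun s => (k s : ℂ))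
      (hk' : HasCompactSupport fun s => (k s : ℂ)), (∀ s, 0 ≤ k s) → 0 < k 1 →
      (∀ s, s ∉ O → k s = 0) → T * conv m (fun s => (k s : ℂ)) hk hk' ≠ 0 := by
  obtain ⟨ξ, hξ⟩ : ∃ ξ, T ξ ≠ 0 := by
    by_contra! H
    exact hT (ContinuousLinearMap.ext H)
  set b : Γ → ℝ := fun s => RCLike.re (inner ℂ (T ξ) (T (transl m s ξ))) with hb
  have hbc : Continuous b := RCLike.continuous_re.comp
    (continuous_const.inner (T.continuous.comp (continuous_transl m ξ)))
  have hb1 : 0 < b 1 := by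
    have : b 1 = ‖T ξ‖ ^ 2 := by
      simp only [hb, map_one, one_apply_eq_self, inner_self_eq_norm_sq]
    rw [this]; positivity
  refine ⟨{s | 0 < b s}, (isOpen_lt continuous_const hbc).mem_nhds hb1, ?_⟩
  intro k hk hk' hk0 hk1 hkO h0
  have h1 := inner_conv m hk hk' T ξ (T ξ)
  rw [← mul_apply_eq_comp, h0] at h1
  simp only [zero_apply, inner_zero_right] at h1
  have hint : Integrable (fun s => (k s : ℂ) * inner ℂ (T ξ) (T (transl m s ξ))) m :=
    Continuous.integrable_of_hasCompactSupport
      (hk.mul (continuous_const.inner (T.continuous.comp (continuous_transl m ξ)))) hk'.mul_right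
  have h2 := congrArg RCLike.re h1.symm
  rw [← integral_re hint] at h2
  have h3 : (fun s => RCLike.re ((k s : ℂ) * inner ℂ (T ξ) (T (transl m s ξ)))) =
      fun s => k s * b s := by
    ext s; simp [hb]
  rw [h3] at h2
  have hkr : Continuous k := by
    have := Complex.continuous_re.comp hk
    simpa [Function.comp_def] using this
  have hkr' : HasCompactSupport k := by
    refine hk'.mono' (fun s hs => subset_closure ?_)
    simpa using hs
  have h4 : 0 < ∫ s, k s * b s ∂m := by
    refine Continuous.integral_pos_of_hasCompactSupport_nonneg_nonzero (x := 1) (hkr.mul hbc)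
      hkr'.mul_right (fun s => ?_) ?_
    · by_cases hs : s ∈ {s | 0 < b s}
      · exact mul_nonneg (hk0 s) (le_of_lt hs)
      · simp [hkO s hs]
    · exact (mul_pos hk1 hb1).ne'
  simp at h2
  linarith

lemma transl_ne_one [m.IsOpenPosMeasure] (r : Γ) (hr : r ≠ 1) : transl m r ≠ 1 := by
  intro H
  have hopen : ∃ V ∈ 𝓝 (1 : Γ), ∀ s ∈ V, r * s ∉ V := by
    obtain ⟨A, B, hA, hB, hrA, hB1, hAB⟩ := t2_separation hr
    refine ⟨B ∩ (fun s => r * s) ⁻¹' A, inter_mem (hB.mem_nhds hB1)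
      ((continuous_const.mul continuous_id).continuousAt.preimage_mem_nhds
        (hA.mem_nhds (by simpa using hrA))), ?_⟩
    rintro s ⟨_, hs⟩ ⟨h, _⟩
    exact Set.disjoint_left.1 hAB hs h
  obtain ⟨V, hV, hrV⟩ := hopen
  obtain ⟨W, hWV, hW, h1W⟩ := mem_nhds_iff.1 hV
  obtain ⟨f, hf1, hf2, hf3, -⟩ := exists_continuous_one_zero_of_isCompact
    (isCompact_singleton (x := (1 : Γ))) hW.isClosed_compl (by simpa using h1W)
  set F : Γ → ℂ := fun s => (f s : ℂ) with hF
  have hFc : Continuous F := Complex.continuous_ofReal.comp f.continuous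
  have hFs : HasCompactSupport F := hf3.comp_left (g := fun x : ℝ => (x : ℂ)) (by simp)
  have hFm : MemLp F 2 m := hFc.memLp_of_hasCompactSupport hFs
  have h1 : inner ℂ (hFm.toLp F) (transl m r (hFm.toLp F)) = 0 := by
    rw [transl_toLp, inner_toLp]
    rw [← integral_zero Γ ℂ (μ := m)]
    congr 1; ext1 s
    by_cases hsW : s ∈ W
    · have : f (r * s) = 0 := hf2 (fun h => hrV s (hWV hsW) (hWV h))
      simp [hF, this]
    · have : f s = 0 := hf2 hsW
      simp [hF, this]
  rw [H, one_apply_eq_self, inner_self_eq_zero] at h1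
  have h2 : F =ᵐ[m] 0 := by
    have := hFm.coeFn_toLp
    rw [h1] at this
    exact this.symm.trans (Lp.coeFn_zero _ _ _)
  have h3 : F = 0 := (hFc.ae_eq_iff_eq m continuous_const).1 h2
  have h4 := congrFun h3 1
  have h5 : f 1 = 1 := hf1 rfl
  simp [hF, h5] at h4
end group

open Filter Topology MeasureTheory
set_option linter.unusedSectionVars false

section bundle
variable {G X : Type*} [TopologicalSpace G] [TopologicalSpace X]

abbrev Fib (B : AbelianGroupBundle G X) (x : X) : Type _ := {s : G // B.p s = x}

noncomputable instance Fib.commGroup (B : AbelianGroupBundle G X) (x : X) : CommGroup (Fib B x) where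
  mul s t := ⟨B.mul s.1 t.1 (s.2.trans t.2.symm), (B.p_mul s.1 t.1 (s.2.trans t.2.symm)).trans s.2⟩
  one := ⟨B.unit x, B.p_unit x⟩
  inv s := ⟨B.inv s.1, (B.p_inv s.1).trans s.2⟩
  mul_assoc a b c := Subtype.ext (B.mul_assoc _ _ _ _ _)
  mul_comm a b := Subtype.ext (B.mul_comm _ _ _)
  one_mul a := by
    obtain ⟨a, rfl⟩ := a
    exact Subtype.ext (B.unit_mul a)
  mul_one a := by
    obtain ⟨a, rfl⟩ := a
    refine Subtype.ext ((B.mul_comm _ _ _).trans (B.unit_mul a))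
  inv_mul_cancel a := by
    obtain ⟨a, rfl⟩ := a
    exact Subtype.ext (B.inv_mul a)

variable (B : AbelianGroupBundle G X)

lemma Fib.coe_mul {x : X} (s t : Fib B x) :
    ((s * t : Fib B x) : G) = B.mul s.1 t.1 (s.2.trans t.2.symm) := rfl
lemma Fib.coe_one {x : X} : ((1 : Fib B x) : G) = B.unit x := rfl
lemma Fib.coe_inv {x : X} (s : Fib B x) : ((s⁻¹ : Fib B x) : G) = B.inv s.1 := rfl

/-- total multiplication -/
noncomputable def mulT (w s : G) : G := open scoped Classical in
  if h : B.p w = B.p s then B.mul w s h else s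

lemma mulT_coe {x : X} (s t : Fib B x) : mulT B s.1 t.1 = ((s * t : Fib B x) : G) := by
  unfold mulT
  rw [dif_pos (s.2.trans t.2.symm)]
  rfl

lemma mulT_eq {w s : G} (h : B.p w = B.p s) : mulT B w s = B.mul w s h := by
  unfold mulT
  rw [dif_pos h]

lemma p_mulT {w s : G} (h : B.p w = B.p s) : B.p (mulT B w s) = B.p w := by
  rw [mulT_eq B h, B.p_mul]

lemma mulT_eq_fib {x : X} {w s : G} (h : B.p w = x) (h' : B.p s = x) :
    mulT B w s = (((⟨w, h⟩ : Fib B x) * ⟨s, h'⟩ : Fib B x) : G) := mulT_coe B (⟨w, h⟩ : Fib B x) ⟨s, h'⟩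

lemma continuousOn_mulT : ContinuousOn (fun q : G × G => mulT B q.1 q.2) {q | B.p q.1 = B.p q.2} := by
  rw [continuousOn_iff_continuous_domRestrict]
  refine B.continuous_mul.congr fun q => ?_
  exact (mulT_eq B q.2).symm

lemma tendsto_mulT {ι : Type*} {l : Filter ι} {a b : ι → G} {a₀ b₀ : G} (h : ∀ i, B.p (a i) = B.p (b i))
    (h₀ : B.p a₀ = B.p b₀) (ha : Tendsto a l (𝓝 a₀)) (hb : Tendsto b l (𝓝 b₀)) :
    Tendsto (fun i => mulT B (a i) (b i)) l (𝓝 (mulT B a₀ b₀)) := by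
  have := continuousOn_mulT B (a₀, b₀) h₀
  refine Tendsto.comp (f := fun i => (a i, b i)) this ?_
  refine tendsto_nhdsWithin_iff.2 ⟨ha.prodMk_nhds hb, Eventually.of_forall h⟩

instance Fib.topGroup (x : X) : IsTopologicalGroup (Fib B x) where
  continuous_mul := by
    refine Continuous.subtype_mk ?_ _
    have : Continuous fun q : Fib B x × Fib B x =>
      (⟨(q.1.1, q.2.1), q.1.2.trans q.2.2.symm⟩ : {q : G × G // B.p q.1 = B.p q.2}) := by fun_prop
    exact B.continuous_mul.comp this
  continuous_inv := by
    refine Continuous.subtype_mk ?_ _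
    exact B.continuous_inv.comp continuous_subtype_val

lemma Fib.isClosed [T2Space X] (x : X) : IsClosed {s : G | B.p s = x} :=
  isClosed_eq B.continuous_p continuous_const

instance Fib.locallyCompact [T2Space X] [LocallyCompactSpace G] (x : X) :
    LocallyCompactSpace (Fib B x) :=
  (Fib.isClosed B x).isClosedEmbedding_subtypeVal.locallyCompactSpace

instance Fib.secondCountable [SecondCountableTopology G] (x : X) :
    SecondCountableTopology (Fib B x) :=
  Topology.IsEmbedding.subtypeVal.secondCountableTopology

variable [SecondCountableTopology G] [SecondCountableTopology X]
    [LocallyCompactSpace G] [LocallyCompactSpace X] [T2Space G] [T2Space X]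
    [MeasurableSpace G] [BorelSpace G] (β : X → Measure G)

noncomputable def fm (x : X) : Measure (Fib B x) := (β x).comap Subtype.val

lemma Fib.measurableEmbedding (x : X) : MeasurableEmbedding (Subtype.val : Fib B x → G) :=
  MeasurableEmbedding.subtype_coe (Fib.isClosed B x).measurableSet

variable {B β}

lemma map_fm (hβ : IsHaarSystem B β) (x : X) : (fm B β x).map Subtype.val = β x := by
  rw [fm, (Fib.measurableEmbedding B x).map_comap, Subtype.range_coe_subtype]
  refine Measure.restrict_eq_self_of_ae_mem ?_
  exact hβ.supported x

lemma integral_fm {E : Type*} [NormedAddCommGroup E] [NormedSpace ℝ E] (hβ : IsHaarSystem B β) (x : X) (f : G → E) :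
    ∫ s, f s.1 ∂(fm B β x) = ∫ s, f s ∂(β x) := by
  conv_rhs => rw [← map_fm hβ x]
  rw [(Fib.measurableEmbedding B x).integral_map]

lemma fm_invariant (hβ : IsHaarSystem B β) (x : X) : (fm B β x).IsMulLeftInvariant := by
  refine ⟨fun g => ?_⟩
  have h1 := hβ.invariant x g.1 g.2
  change Measure.map (mulT B g.1) (β x) = β x at h1
  have hm : AEMeasurable (mulT B g.1) (β x) := by
    by_contra h
    rw [Measure.map_of_not_aemeasurable h] at h1
    exact hβ.ne_zero x h1.symm
  have hmul : Measurable (fun t : Fib B x => g * t) := (continuous_const.mul continuous_id).measurable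
  have hme := Fib.measurableEmbedding B x
  have h2 : Measure.map Subtype.val (Measure.map (g * ·) (fm B β x)) =
      Measure.map Subtype.val (fm B β x) := by
    rw [Measure.map_map hme.measurable hmul, map_fm hβ]
    conv_rhs => rw [← h1]
    rw [← map_fm hβ x] at hm ⊢
    rw [AEMeasurable.map_map_of_aemeasurable hm hme.measurable.aemeasurable]
    congr 1
    ext t
    exact (mulT_coe B g t).symm
  rw [← hme.comap_map (Measure.map (g * ·) (fm B β x)), h2, hme.comap_map]

lemma fm_finite (hβ : IsHaarSystem B β) (x : X) : IsFiniteMeasureOnCompacts (fm B β x) := by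
  refine ⟨fun K hK => ?_⟩
  have := hβ.regular x
  have hme := Fib.measurableEmbedding B x
  have h := hme.map_apply (fm B β x) (Subtype.val '' K)
  rw [Set.preimage_image_eq _ Subtype.val_injective, map_fm hβ] at h
  rw [← h]
  exact (hK.image continuous_subtype_val).measure_lt_top

lemma fm_regular (hβ : IsHaarSystem B β) (x : X) : (fm B β x).Regular := by
  have := fm_finite hβ x
  have : IsLocallyFiniteMeasure (fm B β x) := isLocallyFiniteMeasure_of_isFiniteMeasureOnCompacts
  have : TopologicalSpace.MetrizableSpace (Fib B x) := TopologicalSpace.metrizableSpace_of_t3_secondCountable _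
  infer_instance

lemma fm_neZero (hβ : IsHaarSystem B β) (x : X) : NeZero (fm B β x) := by
  refine ⟨fun h => hβ.ne_zero x ?_⟩
  rw [← map_fm hβ, h, Measure.map_zero]

lemma fm_openPos (hβ : IsHaarSystem B β) (x : X) : (fm B β x).IsOpenPosMeasure := by
  have := fm_regular hβ x
  have := fm_invariant hβ x
  have := fm_neZero hβ x
  infer_instance

/-- Continuity of parametrised integrals. -/
lemma tendsto_integral_param (hβ : IsHaarSystem B β) 
    (Φ : G × G → ℂ) (hΦ : ContinuousOn Φ {q | B.p q.1 = B.p q.2})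
    (w₀ : G) (K : Set G) (hK : IsCompact K)
    (hΦK : ∀ᶠ w in 𝓝 w₀, ∀ s, B.p w = B.p s → s ∉ K → Φ (w, s) = 0) :
    Tendsto (fun w => ∫ s, Φ (w, s) ∂(β (B.p w))) (𝓝 w₀) (𝓝 (∫ s, Φ (w₀, s) ∂(β (B.p w₀)))) := by
  have hY : IsClosed {q : G × G | B.p q.1 = B.p q.2} :=
    isClosed_eq (B.continuous_p.comp continuous_fst) (B.continuous_p.comp continuous_snd)
  obtain ⟨Ψ, hΨ⟩ := ContinuousMap.exists_restrict_eq (Y := ℂ) hY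
    ⟨_, continuousOn_iff_continuous_domRestrict.1 hΦ⟩
  have hΨ' : ∀ w s, B.p w = B.p s → Ψ (w, s) = Φ (w, s) := fun w s h =>
    DFunLike.congr_fun hΨ ⟨(w, s), h⟩
  obtain ⟨k, hk1, -, hk3, hk4⟩ := exists_continuous_one_zero_of_isCompact hK isClosed_empty
    (Set.disjoint_empty K)
  have hreg := hβ.regular
  have hae : ∀ x, ∀ᵐ s ∂(β x), B.p s = x := fun x => hβ.supported x
  set kc : G → ℂ := fun s => (k s : ℂ) with hkc
  have hkcc : Continuous kc := Complex.continuous_ofReal.comp k.continuous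
  have hkcs : HasCompactSupport kc := hk3.comp_left (g := fun x : ℝ => (x : ℂ)) (by simp)
  have heq : ∀ᶠ w in 𝓝 w₀, ∫ s, Φ (w, s) ∂(β (B.p w)) = ∫ s, kc s * Ψ (w, s) ∂(β (B.p w)) := by
    filter_upwards [hΦK] with w hw
    refine integral_congr_ae ?_
    filter_upwards [hae (B.p w)] with s hs
    rw [hΨ' _ _ hs.symm]
    by_cases hsK : s ∈ K
    · have : k s = 1 := hk1 hsK
      simp [hkc, this]
    · simp [hw s hs.symm hsK]
  have hint : ∀ w x, Integrable (fun s => kc s * Ψ (w, s)) (β x) := fun w x =>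
    Continuous.integrable_of_hasCompactSupport
      (hkcc.mul (Ψ.continuous.comp (by fun_prop))) hkcs.mul_right
  have hlim1 : Tendsto (fun w => ∫ s, kc s * Ψ (w₀, s) ∂(β (B.p w))) (𝓝 w₀)
      (𝓝 (∫ s, kc s * Ψ (w₀, s) ∂(β (B.p w₀)))) := by
    have := hβ.continuous_integral (fun s => kc s * Ψ (w₀, s))
      (hkcc.mul (Ψ.continuous.comp (by fun_prop))) hkcs.mul_right
    exact (this.comp B.continuous_p).tendsto w₀
  have hbd : Tendsto (fun w => ∫ s, k s ∂(β (B.p w))) (𝓝 w₀) (𝓝 (∫ s, k s ∂(β (B.p w₀)))) := by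
    have := hβ.continuous_integral kc hkcc hkcs
    have h2 := ((Complex.continuous_re.comp this).comp B.continuous_p).tendsto w₀
    simpa [hkc, Function.comp_def, integral_complex_ofReal] using h2
  set M := ∫ s, k s ∂(β (B.p w₀)) with hM
  have hM0 : 0 ≤ M := integral_nonneg fun s => (hk4 s).1
  rw [tendsto_congr' heq, heq.self_of_nhds]
  have hdiff : Tendsto (fun w => ∫ s, kc s * Ψ (w, s) ∂(β (B.p w)) - ∫ s, kc s * Ψ (w₀, s) ∂(β (B.p w)))
      (𝓝 w₀) (𝓝 0) := by
    rw [Metric.tendsto_nhds]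
    intro ε hε
    have hcur : TendstoUniformlyOn (fun w s => Ψ (w, s)) (fun s => Ψ (w₀, s)) (𝓝 w₀) (tsupport k) := by
      have h1 : Tendsto (fun w => Ψ.curry w) (𝓝 w₀) (𝓝 (Ψ.curry w₀)) :=
        Ψ.curry.continuous.tendsto w₀
      exact ContinuousMap.tendsto_iff_forall_isCompact_tendstoUniformlyOn.1 h1 _ hk3
    have hδ : 0 < ε / (M + 2) := by positivity
    filter_upwards [Metric.tendstoUniformlyOn_iff.1 hcur _ hδ,
      hbd.eventually (gt_mem_nhds (show M < M + 1 by linarith))] with w hw hw2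
    rw [dist_zero_right, ← integral_sub (hint _ _) (hint _ _)]
    calc ‖∫ s, (kc s * Ψ (w, s) - kc s * Ψ (w₀, s)) ∂(β (B.p w))‖
        ≤ ∫ s, k s * (ε / (M + 2)) ∂(β (B.p w)) := by
          refine norm_integral_le_of_norm_le ?_ (Eventually.of_forall fun s => ?_)
          · exact (k.continuous.integrable_of_hasCompactSupport hk3).mul_const _
          · rw [← mul_sub, norm_mul]
            by_cases hs : s ∈ tsupport k
            · have h1 := hw s hs
              rw [dist_comm, dist_eq_norm] at h1
              have h2 : ‖kc s‖ = k s := by simp [hkc, abs_of_nonneg (hk4 s).1]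
              rw [h2]
              exact mul_le_mul_of_nonneg_left h1.le (hk4 s).1
            · have : k s = 0 := image_eq_zero_of_notMem_tsupport hs
              simp [hkc, this]
      _ = (∫ s, k s ∂(β (B.p w))) * (ε / (M + 2)) := integral_mul_const _ _
      _ ≤ (M + 1) * (ε / (M + 2)) := by gcongr
      _ < ε := by
          rw [mul_div_assoc', div_lt_iff₀ (by positivity)]
          nlinarith
  have := hdiff.add hlim1
  simpa using this

end bundle

open Filter Topology MeasureTheory
set_option linter.unusedSectionVars false

section bundle2
variable {G X : Type*} [TopologicalSpace G] [TopologicalSpace X]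
    [SecondCountableTopology G] [SecondCountableTopology X]
    [LocallyCompactSpace G] [LocallyCompactSpace X] [T2Space G] [T2Space X]
    [MeasurableSpace G] [BorelSpace G]

abbrev CC (G : Type*) [TopologicalSpace G] := CompactlySupportedContinuousMap G ℂ

lemma tendsto_div (B : AbelianGroupBundle G X) {ι : Type*} {l : Filter ι} {a b : ι → G} {a₀ b₀ : G}
    (h : ∀ i, B.p (a i) = B.p (b i))
    (h₀ : B.p a₀ = B.p b₀) (ha : Tendsto a l (𝓝 a₀)) (hb : Tendsto b l (𝓝 b₀)) :
    Tendsto (fun i => mulT B (a i) (B.inv (b i))) l (𝓝 (mulT B a₀ (B.inv b₀))) :=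
  tendsto_mulT B (fun i => (h i).trans (B.p_inv _).symm) (h₀.trans (B.p_inv _).symm) ha
    ((B.continuous_inv.tendsto _).comp hb)

/-- quotient set of two compact sets -/
def divSet (B : AbelianGroupBundle G X) (K L : Set G) : Set G :=
  (fun q : G × G => mulT B q.1 (B.inv q.2)) '' ((K ×ˢ L) ∩ {q | B.p q.1 = B.p q.2})

lemma isCompact_divSet (B : AbelianGroupBundle G X) {K L : Set G} (hK : IsCompact K) (hL : IsCompact L) :
    IsCompact (divSet B K L) := by
  have hY : IsClosed {q : G × G | B.p q.1 = B.p q.2} :=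
    isClosed_eq (B.continuous_p.comp continuous_fst) (B.continuous_p.comp continuous_snd)
  refine ((hK.prod hL).inter_right hY).image_of_continuousOn ?_
  refine ContinuousOn.mono ?_ Set.inter_subset_right
  refine (continuousOn_mulT B).comp (f := fun q : G × G => (q.1, B.inv q.2)) ?_ ?_
  · exact (continuous_fst.prodMk (B.continuous_inv.comp continuous_snd)).continuousOn
  · intro q hq
    exact Eq.trans hq (B.p_inv _).symm

lemma mem_divSet (B : AbelianGroupBundle G X) {K L : Set G} {x : X} (w s : Fib B x)
    (h1 : ((w * s : Fib B x) : G) ∈ K) (h2 : s.1 ∈ L) : w.1 ∈ divSet B K L := by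
  refine ⟨((w * s : Fib B x), s), ⟨⟨h1, h2⟩, (w * s).2.trans s.2.symm⟩, ?_⟩
  have := mulT_coe B (w * s) s⁻¹
  simpa [Fib.coe_inv] using this

variable {B : AbelianGroupBundle G X} {β : X → Measure G} [hβ : Fact (IsHaarSystem B β)]

instance (x : X) : (fm B β x).Regular := fm_regular hβ.out x
instance (x : X) : (fm B β x).IsMulLeftInvariant := fm_invariant hβ.out x
instance (x : X) : (fm B β x).IsOpenPosMeasure := fm_openPos hβ.out x

variable (B β)

/-- correlation of two functions -/
noncomputable def J (f g : CC G) : CC G where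
  toFun w := ∫ s, f (mulT B w s) * g s ∂(β (B.p w))
  continuous_toFun := by
    rw [continuous_iff_continuousAt]
    intro w₀
    refine tendsto_integral_param hβ.out (fun q => f (mulT B q.1 q.2) * g q.2) ?_ w₀ (tsupport g)
      g.hasCompactSupport ?_
    · exact (f.continuous.comp_continuousOn (continuousOn_mulT B)).mul
        (g.continuous.comp continuous_snd).continuousOn
    · refine Eventually.of_forall fun w s _ hs => ?_
      simp [image_eq_zero_of_notMem_tsupport hs]
  hasCompactSupport' := by
    refine HasCompactSupport.intro
      (isCompact_divSet B f.hasCompactSupport g.hasCompactSupport) fun w hw => ?_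
    refine integral_eq_zero_of_ae ?_
    have hae : ∀ᵐ s ∂(β (B.p w)), B.p s = B.p w := hβ.out.supported _
    filter_upwards [hae] with s hs
    by_contra hne
    refine hw ?_
    have h1 : f (mulT B w s) ≠ 0 := fun h => hne (by simp [h])
    have h2 : g s ≠ 0 := fun h => hne (by simp [h])
    refine mem_divSet B (⟨w, rfl⟩ : Fib B (B.p w)) ⟨s, hs⟩ (subset_closure ?_) (subset_closure h2)
    rw [← mulT_coe]
    exact h1

lemma J_apply (f g : CC G) (w : G) : J B β f g w = ∫ s, f (mulT B w s) * g s ∂(β (B.p w)) := rfl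

lemma J_fib (f g : CC G) {x : X} (w : Fib B x) :
    J B β f g w = ∫ s : Fib B x, f (w * s : Fib B x) * g s ∂(fm B β x) := by
  obtain ⟨w, rfl⟩ := w
  rw [J_apply, ← integral_fm hβ.out]
  congr 1; ext1 s
  rw [← mulT_coe]

/-- modulus of continuity of translation in `L¹` -/
noncomputable def DD (h : CC G) (w : G) : ℝ := ∫ s, ‖h (mulT B (B.inv w) s) - h s‖ ∂(β (B.p w))

lemma DD_fib (h : CC G) {x : X} (w : Fib B x) :
    DD B β h w = ∫ s : Fib B x, ‖h (w⁻¹ * s : Fib B x) - h s‖ ∂(fm B β x) := by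
  obtain ⟨w, rfl⟩ := w
  rw [DD, ← integral_fm hβ.out]
  congr 1; ext1 s
  rw [← mulT_coe]
  rfl

lemma continuous_DD (h : CC G) : Continuous (DD B β h) := by
  rw [continuous_iff_continuousAt]
  intro w₀
  obtain ⟨N, hN, hNw⟩ := exists_compact_mem_nhds w₀
  have hmul : ContinuousOn (fun q : G × G => mulT B (B.inv q.1) q.2) {q | B.p q.1 = B.p q.2} := by
    refine (continuousOn_mulT B).comp (f := fun q : G × G => (B.inv q.1, q.2)) ?_ ?_
    · exact ((B.continuous_inv.comp continuous_fst).prodMk continuous_snd).continuousOn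
    · intro q hq
      exact Eq.trans (B.p_inv _) hq
  have key := tendsto_integral_param hβ.out
    (fun q => ((‖h (mulT B (B.inv q.1) q.2) - h q.2‖ : ℝ) : ℂ)) ?_ w₀
    (divSet B (tsupport h) (B.inv '' N) ∪ tsupport h)
    ((isCompact_divSet B h.hasCompactSupport (hN.image B.continuous_inv)).union
      h.hasCompactSupport) ?_
  · have h2 := (Complex.continuous_re.tendsto _).comp key
    have h3 : Tendsto (fun w => ∫ s, ‖h (mulT B (B.inv w) s) - h s‖ ∂(β (B.p w))) (𝓝 w₀)
        (𝓝 (∫ s, ‖h (mulT B (B.inv w₀) s) - h s‖ ∂(β (B.p w₀)))) := by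
      simpa only [Function.comp_def, integral_complex_ofReal, Complex.ofReal_re] using h2
    exact h3
  · refine Complex.continuous_ofReal.comp_continuousOn (ContinuousOn.norm ?_)
    exact (h.continuous.comp_continuousOn hmul).sub (h.continuous.comp continuous_snd).continuousOn
  · filter_upwards [hNw] with w hw s hws hs
    have h1 : h s = 0 := image_eq_zero_of_notMem_tsupport fun h => hs (Or.inr h)
    have h2 : h (mulT B (B.inv w) s) = 0 := by
      refine image_eq_zero_of_notMem_tsupport fun h => hs (Or.inl ?_)
      refine mem_divSet B (⟨s, hws.symm⟩ : Fib B (B.p w)) (⟨w, rfl⟩ : Fib B (B.p w))⁻¹ ?_ ⟨w, hw, rfl⟩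
      rw [mul_comm, ← mulT_coe]
      exact h
    simp [h1, h2]

lemma DD_one (h : CC G) (x : X) : DD B β h (1 : Fib B x) = 0 := by
  rw [DD_fib]; simp

lemma exists_bump {s : G} {O : Set G} (hO : O ∈ 𝓝 s) :
    ∃ f : C(G, ℝ), HasCompactSupport f ∧ (∀ t, 0 ≤ f t) ∧ f s = 1 ∧ ∀ t, t ∉ O → f t = 0 := by
  obtain ⟨W, hWV, hW, h1W⟩ := mem_nhds_iff.1 hO
  obtain ⟨f, hf1, hf2, hf3, hf4⟩ := exists_continuous_one_zero_of_isCompact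
    (isCompact_singleton (x := s)) hW.isClosed_compl (by simpa using h1W)
  exact ⟨f, hf3, fun t => (hf4 t).1, hf1 rfl, fun t ht => hf2 fun h => ht (hWV h)⟩

lemma isOpenMap_p (h0 : IsHaarSystem B β) : IsOpenMap B.p := by
  have hβ : Fact (IsHaarSystem B β) := ⟨h0⟩
  rw [isOpenMap_iff_nhds_le]
  intro s O hO
  obtain ⟨f, hf1, hf2, hf3, hf4⟩ := exists_bump (mem_map.1 hO)
  have hc := hβ.out.continuous_integral (fun s => (f s : ℂ)) (Complex.continuous_ofReal.comp f.continuous)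
    (hf1.comp_left (g := fun x : ℝ => (x : ℂ)) (by simp))
  have hc' : Continuous fun x => ∫ t, f t ∂(β x) := by
    have := Complex.continuous_re.comp hc
    simpa [Function.comp_def, integral_complex_ofReal] using this
  have hpos : 0 < ∫ t, f t ∂(β (B.p s)) := by
    rw [← integral_fm hβ.out]
    refine Continuous.integral_pos_of_hasCompactSupport_nonneg_nonzero (x := ⟨s, rfl⟩)
      (f.continuous.comp continuous_subtype_val)
      (hf1.comp_isClosedEmbedding (Fib.isClosed B _).isClosedEmbedding_subtypeVal)
      (fun t => hf2 _) ?_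
    simp [hf3]
  filter_upwards [(isOpen_lt continuous_const hc').mem_nhds hpos] with x hx
  by_contra hxO
  refine lt_irrefl (0 : ℝ) (lt_of_lt_of_eq hx ?_)
  rw [← integral_fm hβ.out]
  refine integral_eq_zero_of_ae (Eventually.of_forall fun t => ?_)
  exact hf4 _ fun h => hxO (by have : B.p t.1 ∈ O := h; rwa [t.2] at this)

/-- sequence lifting -/
lemma exists_lift (h0 : IsHaarSystem B β) {x : ℕ → X} {x₀ : X} (hx : Tendsto x atTop (𝓝 x₀)) (s₀ : Fib B x₀) :
    ∃ t : ∀ n, Fib B (x n), Tendsto (fun n => (t n : G)) atTop (𝓝 s₀) := by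
  let : MetricSpace G := TopologicalSpace.metrizableSpaceMetric G
  have hne : ∀ n, {s : G | B.p s = x n}.Nonempty := fun n => B.surjective_p (x n)
  have h1 : ∀ n, ∃ t : Fib B (x n), dist s₀.1 t < Metric.infDist s₀.1 {s : G | B.p s = x n} + 1 / (n + 1 : ℝ) := by
    intro n
    obtain ⟨y, hy, hy'⟩ := (Metric.infDist_lt_iff (hne n)).1
      (lt_add_of_pos_right (Metric.infDist s₀.1 {s : G | B.p s = x n})
        (show (0:ℝ) < 1 / (n + 1 : ℝ) by positivity))
    exact ⟨⟨y, hy⟩, hy'⟩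
  choose t ht using h1
  refine ⟨t, ?_⟩
  rw [Metric.tendsto_nhds]
  intro ε hε
  have h2 : B.p '' Metric.ball s₀.1 (ε / 2) ∈ 𝓝 x₀ := by
    have := (isOpenMap_p B β h0).image_mem_nhds (Metric.ball_mem_nhds s₀.1 (half_pos hε))
    rwa [s₀.2] at this
  have h3 : Tendsto (fun n : ℕ => 1 / (n + 1 : ℝ)) atTop (𝓝 0) := tendsto_one_div_add_atTop_nhds_zero_nat
  filter_upwards [hx.eventually h2, h3.eventually (gt_mem_nhds (half_pos hε))] with n hn hn2
  obtain ⟨y, hy, hyx⟩ := hn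
  have h4 : Metric.infDist s₀.1 {s : G | B.p s = x n} ≤ dist s₀.1 y :=
    Metric.infDist_le_dist_of_mem hyx
  rw [Metric.mem_ball, dist_comm] at hy
  rw [dist_comm]
  linarith [ht n]

end bundle2

open Filter Topology MeasureTheory
set_option linter.unusedSectionVars false

section bundle3
variable {G X : Type*} [TopologicalSpace G] [TopologicalSpace X]
    [SecondCountableTopology G] [SecondCountableTopology X]
    [LocallyCompactSpace G] [LocallyCompactSpace X] [T2Space G] [T2Space X]
    [MeasurableSpace G] [BorelSpace G]
variable (B : AbelianGroupBundle G X) (β : X → Measure G) [hβ : Fact (IsHaarSystem B β)]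

lemma cont_res (f : CC G) (x : X) : Continuous fun s : Fib B x => f s.1 :=
  f.continuous.comp continuous_subtype_val

lemma supp_res (f : CC G) (x : X) : HasCompactSupport fun s : Fib B x => f s.1 :=
  f.hasCompactSupport.comp_isClosedEmbedding (Fib.isClosed B x).isClosedEmbedding_subtypeVal

lemma memLp_res (f : CC G) (x : X) : MemLp (fun s : Fib B x => f s.1) 2 (fm B β x) :=
  (cont_res B f x).memLp_of_hasCompactSupport (supp_res B f x)

/-- restriction of a test function to a fibre -/
noncomputable def lf (x : X) (f : CC G) : Lp ℂ 2 (fm B β x) := (memLp_res B β f x).toLp _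

/-- convolution operator on a fibre -/
noncomputable def cv (x : X) (h : CC G) : Lp ℂ 2 (fm B β x) →L[ℂ] Lp ℂ 2 (fm B β x) :=
  conv (fm B β x) (fun s : Fib B x => h s.1) (cont_res B h x) (supp_res B h x)

lemma inner_transl_lf (ξ η : CC G) {x : X} (w : Fib B x) :
    inner ℂ (lf B β x η) (transl (fm B β x) w (lf B β x ξ)) = J B β ξ (star η) w := by
  rw [lf, lf, transl_toLp, inner_toLp, J_fib]
  rfl

lemma inner_cv_lf (h ξ η : CC G) {x : X} (w : Fib B x) :
    inner ℂ (lf B β x η) ((transl (fm B β x) w * cv B β x h) (lf B β x ξ)) =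
      J B β (J B β ξ (star η)) h w := by
  rw [mul_apply_eq_comp, cv, inner_conv, J_fib]
  congr 1; ext1 s
  rw [← inner_transl_lf, map_mul, mul_apply_eq_comp, mul_comm]

lemma norm_lf (ξ : CC G) (x : X) :
    ‖lf B β x ξ‖ = Real.sqrt (J B β ξ (star ξ) (B.unit x)).re := by
  have := inner_transl_lf B β ξ ξ (1 : Fib B x)
  rw [map_one, one_apply_eq_self, Fib.coe_one] at this
  rw [← this, norm_eq_sqrt_re_inner (𝕜 := ℂ)]
  rfl

lemma continuous_norm_lf (ξ : CC G) : Continuous fun x => ‖lf B β x ξ‖ := by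
  simp only [norm_lf]
  exact Real.continuous_sqrt.comp (Complex.continuous_re.comp
    ((J B β ξ (star ξ)).continuous.comp B.continuous_unit))

lemma exists_extend (x : X) (g : Fib B x → ℂ) (hg : Continuous g) (hg' : HasCompactSupport g) :
    ∃ ξ : CC G, ∀ s : Fib B x, ξ s.1 = g s := by
  obtain ⟨Ψ, hΨ⟩ := ContinuousMap.exists_restrict_eq (Y := ℂ) (Fib.isClosed B x) ⟨g, hg⟩
  obtain ⟨k, hk1, -, hk3, hk4⟩ := exists_continuous_one_zero_of_isCompact
    (hg'.isCompact.image continuous_subtype_val) isClosed_empty (Set.disjoint_empty _)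
  have hkcs : HasCompactSupport fun s => (k s : ℂ) :=
    hk3.comp_left (g := fun x : ℝ => (x : ℂ)) (by simp)
  refine ⟨⟨⟨fun s => (k s : ℂ) * Ψ s,
    (Complex.continuous_ofReal.comp k.continuous).mul Ψ.continuous⟩, hkcs.mul_right⟩, fun s => ?_⟩
  have h1 : Ψ s.1 = g s := DFunLike.congr_fun hΨ s
  show (k s : ℂ) * Ψ s = g s
  rw [h1]
  by_cases hs : s ∈ tsupport g
  · have : k s.1 = 1 := hk1 ⟨s, hs, rfl⟩
    simp [this]
  · simp [image_eq_zero_of_notMem_tsupport hs]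

lemma denseRange_lf (x : X) : DenseRange (lf B β x) := by
  intro f
  rw [Metric.mem_closure_iff]
  intro ε hε
  obtain ⟨g, hg1, hg2, hg3, hg4⟩ := (Lp.memLp f).exists_hasCompactSupport_eLpNorm_sub_le
    (by simp) (ε := ENNReal.ofReal (ε / 2)) (by simpa using hε)
  obtain ⟨ξ, hξ⟩ := exists_extend B x g hg3 hg1
  refine ⟨_, ⟨ξ, rfl⟩, ?_⟩
  rw [dist_eq_norm]
  have h1 : lf B β x ξ = hg4.toLp g := by
    refine MemLp.toLp_congr _ _ (Eventually.of_forall fun s => hξ s)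
  have h2 : f = (Lp.memLp f).toLp f := by simp
  rw [h1]
  nth_rw 1 [h2]
  rw [← MemLp.toLp_sub, Lp.norm_toLp]
  refine lt_of_le_of_lt (ENNReal.toReal_mono (by simp) hg2) ?_
  rw [ENNReal.toReal_ofReal (by positivity)]
  linarith

lemma exists_lf_of_lt (x : X) (T : Lp ℂ 2 (fm B β x) →L[ℂ] Lp ℂ 2 (fm B β x)) {c : ℝ} (hc : 0 ≤ c)
    (hT : c < ‖T‖) : ∃ ξ η : CC G,
      c * (‖lf B β x η‖ * ‖lf B β x ξ‖) < ‖inner ℂ (lf B β x η) (T (lf B β x ξ))‖ := by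
  by_contra! H
  refine absurd (T.opNorm_le_bound hc fun b => ?_) (not_le.2 hT)
  have key : ∀ a b : Lp ℂ 2 (fm B β x), ‖inner ℂ a (T b)‖ ≤ c * (‖a‖ * ‖b‖) := by
    intro a b
    refine (denseRange_lf B β x).induction_on₂ (p := fun a b => ‖inner ℂ a (T b)‖ ≤ c * (‖a‖ * ‖b‖))
      ?_ (fun η ξ => H ξ η) a b
    exact isClosed_le (by fun_prop) (by fun_prop)
  have h := key (T b) b
  rw [inner_self_eq_norm_sq_to_K, norm_pow, RCLike.norm_ofReal, abs_of_nonneg (norm_nonneg _)] at h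
  rcases (norm_nonneg (T b)).eq_or_lt with h0 | h0
  · rw [← h0]; positivity
  · refine le_of_mul_le_mul_left ?_ h0
    nlinarith

lemma lsc_norm {x : ℕ → X} {x₀ : X} (hx : Tendsto x atTop (𝓝 x₀)) {l : Filter ℕ} (hl : l ≤ atTop)
    (T : ∀ n, Lp ℂ 2 (fm B β (x n)) →L[ℂ] Lp ℂ 2 (fm B β (x n)))
    (T₀ : Lp ℂ 2 (fm B β x₀) →L[ℂ] Lp ℂ 2 (fm B β x₀))
    (hT : ∀ ξ η : CC G, Tendsto (fun n => inner ℂ (lf B β (x n) η) (T n (lf B β (x n) ξ))) l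
      (𝓝 (inner ℂ (lf B β x₀ η) (T₀ (lf B β x₀ ξ)))))
    {c : ℝ} (hc : 0 ≤ c) (hcT : c < ‖T₀‖) : ∀ᶠ n in l, c < ‖T n‖ := by
  obtain ⟨ξ, η, h⟩ := exists_lf_of_lt B β x₀ T₀ hc hcT
  have h1 : Tendsto (fun n => c * (‖lf B β (x n) η‖ * ‖lf B β (x n) ξ‖)) l
      (𝓝 (c * (‖lf B β x₀ η‖ * ‖lf B β x₀ ξ‖))) :=
    ((((continuous_norm_lf B β η).tendsto x₀).comp (hx.mono_left hl)).mul
      (((continuous_norm_lf B β ξ).tendsto x₀).comp (hx.mono_left hl))).const_mul c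
  filter_upwards [h1.eventually_lt (hT ξ η).norm h] with n hn
  by_contra! hle
  have h2 := norm_inner_le_norm (𝕜 := ℂ) (lf B β (x n) η) (T n (lf B β (x n) ξ))
  have h3 : ‖T n (lf B β (x n) ξ)‖ ≤ c * ‖lf B β (x n) ξ‖ :=
    ((T n).le_opNorm _).trans (by gcongr)
  have h4 : ‖lf B β (x n) η‖ * ‖T n (lf B β (x n) ξ)‖ ≤ ‖lf B β (x n) η‖ * (c * ‖lf B β (x n) ξ‖) := by
    gcongr
  linarith

end bundle3

open Filter Topology MeasureTheory
set_option linter.unusedSectionVars false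

section bundle4
variable {G X : Type*} [TopologicalSpace G] [TopologicalSpace X]
    [SecondCountableTopology G] [SecondCountableTopology X]
    [LocallyCompactSpace G] [LocallyCompactSpace X] [T2Space G] [T2Space X]
    [MeasurableSpace G] [BorelSpace G]
variable (B : AbelianGroupBundle G X) (β : X → Measure G) [hβ : Fact (IsHaarSystem B β)]

/-- the representation of the group algebra of a fibre, damped by a convolution operator -/
noncomputable def op (x : X) (h : CC G) (a : MonoidAlgebra ℂ (Fib B x)) :
    Lp ℂ 2 (fm B β x) →L[ℂ] Lp ℂ 2 (fm B β x) :=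
  MonoidAlgebra.lift ℂ (Lp ℂ 2 (fm B β x) →L[ℂ] Lp ℂ 2 (fm B β x)) (Fib B x) (transl (fm B β x)) a
    * cv B β x h

/-- matrix coefficients -/
noncomputable def Lam (x : X) (h ξ η : CC G) (a : MonoidAlgebra ℂ (Fib B x)) : ℂ :=
  inner ℂ (lf B β x η) (op B β x h a (lf B β x ξ))

lemma op_add (x : X) (h : CC G) (a b : MonoidAlgebra ℂ (Fib B x)) :
    op B β x h (a + b) = op B β x h a + op B β x h b := by
  simp only [op, map_add, add_mul]

lemma op_sub (x : X) (h : CC G) (a b : MonoidAlgebra ℂ (Fib B x)) :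
    op B β x h (a - b) = op B β x h a - op B β x h b := by
  simp only [op, map_sub, sub_mul]

lemma op_smul (x : X) (h : CC G) (c : ℂ) (a : MonoidAlgebra ℂ (Fib B x)) :
    op B β x h (c • a) = c • op B β x h a := by
  simp only [op, map_smul, smul_mul_assoc]

lemma op_of (x : X) (h : CC G) (w : Fib B x) :
    op B β x h (MonoidAlgebra.of ℂ _ w) = transl (fm B β x) w * cv B β x h := by
  simp only [op, MonoidAlgebra.lift_of]

lemma op_one (x : X) (h : CC G) : op B β x h 1 = cv B β x h := by
  simp only [op, map_one, one_mul]

variable (h ξ η : CC G)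

lemma Lam_add (x : X) (a b : MonoidAlgebra ℂ (Fib B x)) :
    Lam B β x h ξ η (a + b) = Lam B β x h ξ η a + Lam B β x h ξ η b := by
  simp only [Lam, op_add, add_apply, inner_add_right]

lemma Lam_sub (x : X) (a b : MonoidAlgebra ℂ (Fib B x)) :
    Lam B β x h ξ η (a - b) = Lam B β x h ξ η a - Lam B β x h ξ η b := by
  simp only [Lam, op_sub, sub_apply, inner_sub_right]

lemma Lam_smul (x : X) (c : ℂ) (a : MonoidAlgebra ℂ (Fib B x)) :
    Lam B β x h ξ η (c • a) = c * Lam B β x h ξ η a := by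
  simp only [Lam, op_smul, smul_apply, inner_smul_right]

lemma Lam_of (x : X) (w : Fib B x) :
    Lam B β x h ξ η (MonoidAlgebra.of ℂ _ w) = J B β (J B β ξ (star η)) h w := by
  rw [Lam, op_of, inner_cv_lf]

/-- evaluation of a polynomial at group elements -/
noncomputable def pe {Γ : Type*} [CommGroup Γ] (t : ℕ → Γ) (P : MvPolynomial ℕ ℂ) : MonoidAlgebra ℂ Γ :=
  MvPolynomial.aeval (fun j => MonoidAlgebra.of ℂ Γ (t j)) P

lemma pe_mul_X {Γ : Type*} [CommGroup Γ] (t : ℕ → Γ) (P : MvPolynomial ℕ ℂ) (j : ℕ) (w : Γ) :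
    MonoidAlgebra.of ℂ Γ w * pe t (P * MvPolynomial.X j) = MonoidAlgebra.of ℂ Γ (w * t j) * pe t P := by
  rw [pe, pe, map_mul, MvPolynomial.aeval_X, map_mul]; ring

lemma pe_C {Γ : Type*} [CommGroup Γ] (t : ℕ → Γ) (c : ℂ) (w : Γ) :
    MonoidAlgebra.of ℂ Γ w * pe t (MvPolynomial.C c) = c • MonoidAlgebra.of ℂ Γ w := by
  rw [pe, MvPolynomial.algHom_C, Algebra.smul_def, mul_comm]

lemma pe_add {Γ : Type*} [CommGroup Γ] (t : ℕ → Γ) (P Q : MvPolynomial ℕ ℂ) (w : Γ) :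
    MonoidAlgebra.of ℂ Γ w * pe t (P + Q) =
      MonoidAlgebra.of ℂ Γ w * pe t P + MonoidAlgebra.of ℂ Γ w * pe t Q := by
  rw [pe, map_add, mul_add]; rfl

variable {x : ℕ → X} {x₀ : X} {l : Filter ℕ} (t : ℕ → Fib B x₀) (tn : ∀ n, ℕ → Fib B (x n))
  (ht : ∀ j, Tendsto (fun n => (tn n j : G)) l (𝓝 (t j)))

lemma tendsto_fib_mul {a b : ∀ n, Fib B (x n)} {a₀ b₀ : Fib B x₀}
    (ha : Tendsto (fun n => (a n : G)) l (𝓝 a₀)) (hb : Tendsto (fun n => (b n : G)) l (𝓝 b₀)) :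
    Tendsto (fun n => ((a n * b n : Fib B (x n)) : G)) l (𝓝 (a₀ * b₀ : Fib B x₀)) := by
  simp only [← mulT_coe]
  exact tendsto_mulT B (fun n => (a n).2.trans (b n).2.symm) (a₀.2.trans b₀.2.symm) ha hb

lemma tendsto_fib_inv {a : ∀ n, Fib B (x n)} {a₀ : Fib B x₀}
    (ha : Tendsto (fun n => (a n : G)) l (𝓝 a₀)) :
    Tendsto (fun n => (((a n)⁻¹ : Fib B (x n)) : G)) l (𝓝 (a₀⁻¹ : Fib B x₀)) :=
  (B.continuous_inv.tendsto _).comp ha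

lemma tendsto_Lam (ht : ∀ j, Tendsto (fun n => (tn n j : G)) l (𝓝 (t j))) (P : MvPolynomial ℕ ℂ) :
    ∀ (w : ∀ n, Fib B (x n)) (w₀ : Fib B x₀), Tendsto (fun n => (w n : G)) l (𝓝 w₀) →
      Tendsto (fun n => Lam B β (x n) h ξ η (MonoidAlgebra.of ℂ _ (w n) * pe (tn n) P)) l
        (𝓝 (Lam B β x₀ h ξ η (MonoidAlgebra.of ℂ _ w₀ * pe t P))) := by
  induction P using MvPolynomial.induction_on with
  | C c =>
    intro w w₀ hw
    simp only [pe_C, Lam_smul, Lam_of]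
    exact (((J B β (J B β ξ (star η)) h).continuous.tendsto _).comp hw).const_mul c
  | add P Q hP hQ =>
    intro w w₀ hw
    simp only [pe_add, Lam_add]
    exact (hP w w₀ hw).add (hQ w w₀ hw)
  | mul_X P j hP =>
    intro w w₀ hw
    simp only [pe_mul_X]
    exact hP _ _ (tendsto_fib_mul B hw (ht j))

lemma tendsto_Lam_escape (ht : ∀ j, Tendsto (fun n => (tn n j : G)) l (𝓝 (t j)))
    (P : MvPolynomial ℕ ℂ) :
    ∀ (w : ∀ n, Fib B (x n)), (∀ K : Set G, IsCompact K → ∀ᶠ n in l, (w n : G) ∉ K) →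
      Tendsto (fun n => Lam B β (x n) h ξ η (MonoidAlgebra.of ℂ _ (w n) * pe (tn n) P)) l
        (𝓝 0) := by
  induction P using MvPolynomial.induction_on with
  | C c =>
    intro w hw
    simp only [pe_C, Lam_smul, Lam_of]
    refine tendsto_const_nhds.congr' ?_
    filter_upwards [hw _ (J B β (J B β ξ (star η)) h).hasCompactSupport.isCompact] with n hn
    rw [image_eq_zero_of_notMem_tsupport hn, mul_zero]
  | add P Q hP hQ =>
    intro w hw
    simp only [pe_add, Lam_add]
    simpa using (hP w hw).add (hQ w hw)
  | mul_X P j hP =>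
    intro w hw
    simp only [pe_mul_X]
    refine hP _ fun K hK => ?_
    obtain ⟨N, hN, hNw⟩ := exists_compact_mem_nhds (t j : G)
    filter_upwards [hw _ (isCompact_divSet B hK hN), (ht j).eventually hNw] with n h1 h2 h3
    exact h1 (mem_divSet B (w n) (tn n j) h3 h2)

/-- existence of characters in a fibre, norming an element of the group algebra -/
lemma exists_char (x : X) (a : MonoidAlgebra ℂ (Fib B x)) :
    ∃ (ω : Fib B x →* ℂ) (κ : ℝ), 0 ≤ κ ∧ (∀ t, ‖ω t‖ = 1) ∧
      ‖op B β x h a‖ = ‖MonoidAlgebra.lift ℂ ℂ _ ω a‖ * κ ∧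
      ∀ b, ‖MonoidAlgebra.lift ℂ ℂ _ ω b‖ * κ ≤ ‖op B β x h b‖ := by
  rcases subsingleton_or_nontrivial (Lp ℂ 2 (fm B β x)) with hS | hN
  · refine ⟨1, 0, le_rfl, fun t => by simp, ?_, fun b => ?_⟩
    · rw [mul_zero, Subsingleton.elim (op B β x h a) 0, norm_zero]
    · rw [mul_zero]; positivity
  · exact exists_char_of_commute (transl (fm B β x)) (star_transl _) (cv B β x h)
      (transl_conv _ _ _) (star_conv _ _ _) a

lemma char_kappa_le {x : X} {ω : Fib B x →* ℂ} {κ : ℝ}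
    (hω : ∀ b, ‖MonoidAlgebra.lift ℂ ℂ _ ω b‖ * κ ≤ ‖op B β x h b‖) :
    κ ≤ ∫ s, ‖h s‖ ∂(β x) := by
  have h1 := hω 1
  rw [map_one, norm_one, one_mul, op_one] at h1
  refine h1.trans ((norm_conv_le _ _ _).trans_eq ?_)
  exact integral_fm hβ.out x (fun s => ‖h s‖)

lemma char_DD_le {x : X} {ω : Fib B x →* ℂ} {κ : ℝ}
    (hω : ∀ b, ‖MonoidAlgebra.lift ℂ ℂ _ ω b‖ * κ ≤ ‖op B β x h b‖) (t : Fib B x) :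
    ‖ω t - 1‖ * κ ≤ DD B β h t := by
  have h1 := hω (MonoidAlgebra.of ℂ _ t - 1)
  rw [map_sub, MonoidAlgebra.lift_of, map_one, op_sub, op_of, op_one] at h1
  refine h1.trans ((norm_transl_conv_sub _ _ _ _).trans_eq ?_)
  exact (DD_fib B β h t).symm

lemma isCharacter_of_DD {x : X} {ω : Fib B x →* ℂ} {κ : ℝ} (hκ : 0 < κ) (hn : ∀ t, ‖ω t‖ = 1)
    (hω : ∀ t : Fib B x, ‖ω t - 1‖ * κ ≤ DD B β h t) : IsCharacter B x ω where
  norm_one := hn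
  map_mul s t := map_mul ω s t
  continuous_toFun := by
    refine continuous_of_continuousAt_one ω ?_
    rw [ContinuousAt, map_one, tendsto_iff_norm_sub_tendsto_zero]
    have h1 : Tendsto (fun t : Fib B x => DD B β h t / κ) (𝓝 1) (𝓝 0) := by
      have h2 : Tendsto (fun t : Fib B x => DD B β h t) (𝓝 1) (𝓝 (DD B β h (1 : Fib B x))) :=
        ((continuous_DD B β h).comp continuous_subtype_val).tendsto _
      rw [DD_one] at h2
      simpa using h2.div_const κ
    refine squeeze_zero (fun t => norm_nonneg _) (fun t => ?_) h1
    rw [le_div_iff₀ hκ]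
    exact hω t

end bundle4

open Filter Topology MeasureTheory
set_option linter.unusedSectionVars false

section polys

/-- peaking polynomials -/
noncomputable def pk (z : ℕ → ℂ) (N : ℕ) : MvPolynomial ℕ ℂ :=
  ∏ j ∈ Finset.range N, (MvPolynomial.C (1 / 2) *
    (1 + MvPolynomial.C ((starRingEnd ℂ) (z j)) * MvPolynomial.X j)) ^ N

lemma eval_pk (z w : ℕ → ℂ) (N : ℕ) : MvPolynomial.eval w (pk z N) =
    ∏ j ∈ Finset.range N, (1 / 2 * (1 + (starRingEnd ℂ) (z j) * w j)) ^ N := by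
  simp [pk]

lemma conj_mul_self_of_norm {z : ℂ} (hz : ‖z‖ = 1) : (starRingEnd ℂ) z * z = 1 := by
  rw [Complex.conj_mul', hz]; simp

lemma eval_pk_self (z : ℕ → ℂ) (hz : ∀ j, ‖z j‖ = 1) (N : ℕ) : MvPolynomial.eval z (pk z N) = 1 := by
  rw [eval_pk]
  refine Finset.prod_eq_one fun j _ => ?_
  rw [conj_mul_self_of_norm (hz j)]; norm_num

lemma norm_half_le {z w : ℂ} (hz : ‖z‖ = 1) (hw : ‖w‖ = 1) :
    ‖1 / 2 * (1 + (starRingEnd ℂ) z * w)‖ ≤ 1 := by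
  have h1 : ‖(1 : ℂ) + (starRingEnd ℂ) z * w‖ ≤ 1 + 1 :=
    (norm_add_le _ _).trans (by simp [hz, hw])
  rw [norm_mul]
  norm_num
  linarith

lemma norm_eval_pk_le (z w : ℕ → ℂ) (hz : ∀ j, ‖z j‖ = 1) (hw : ∀ j, ‖w j‖ = 1) (N : ℕ) :
    ‖MvPolynomial.eval w (pk z N)‖ ≤ 1 := by
  rw [eval_pk, norm_prod]
  refine Finset.prod_le_one (fun j _ => norm_nonneg _) fun j _ => ?_
  rw [norm_pow]
  exact pow_le_one₀ (norm_nonneg _) (norm_half_le (hz j) (hw j))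

lemma norm_eval_pk_le_pow (z w : ℕ → ℂ) (hz : ∀ j, ‖z j‖ = 1) (hw : ∀ j, ‖w j‖ = 1) {N j : ℕ}
    (hj : j < N) :
    ‖MvPolynomial.eval w (pk z N)‖ ≤ ‖1 / 2 * (1 + (starRingEnd ℂ) (z j) * w j)‖ ^ N := by
  rw [eval_pk, norm_prod, ← Finset.mul_prod_erase _ _ (Finset.mem_range.2 hj), norm_pow]
  refine mul_le_of_le_one_right (by positivity) ?_
  refine Finset.prod_le_one (fun j _ => norm_nonneg _) fun j _ => ?_
  rw [norm_pow]
  exact pow_le_one₀ (norm_nonneg _) (norm_half_le (hz j) (hw j))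

lemma lift_pe {Γ : Type*} [CommGroup Γ] (t : ℕ → Γ) (ω : Γ →* ℂ) (P : MvPolynomial ℕ ℂ) :
    MonoidAlgebra.lift ℂ ℂ Γ ω (pe t P) = MvPolynomial.eval (fun j => ω (t j)) P := by
  rw [pe, ← AlgHom.comp_apply, MvPolynomial.comp_aeval]
  simp only [MonoidAlgebra.lift_of]
  rw [MvPolynomial.aeval_def, MvPolynomial.eval₂_eq_eval_map]
  simp

lemma exists_diag (p : ℕ → ℕ → Prop) (hp : ∀ N, ∀ᶠ n in atTop, p N n) :
    ∃ N : ℕ → ℕ, Tendsto N atTop atTop ∧ ∀ᶠ n in atTop, p (N n) n := by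
  classical
  refine ⟨fun n => Nat.findGreatest (fun N => p N n) n, ?_, ?_⟩
  · rw [tendsto_atTop]
    intro K
    filter_upwards [hp K, eventually_ge_atTop K] with n h1 h2
    exact Nat.le_findGreatest h2 h1
  · filter_upwards [hp 0] with n hn
    exact Nat.findGreatest_spec (P := fun N => p N n) (Nat.zero_le n) hn

/-- unimodular numbers with large peaks converge -/
lemma tendsto_of_peak {z : ℂ} (hz : ‖z‖ = 1) {w : ℕ → ℂ} (hw : ∀ n, ‖w n‖ = 1) {N : ℕ → ℕ}
    (hN : Tendsto N atTop atTop) {δ : ℝ} (hδ : 0 < δ)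
    (hq : ∀ᶠ n in atTop, δ ≤ ‖1 / 2 * (1 + (starRingEnd ℂ) z * w n)‖ ^ (N n)) :
    Tendsto w atTop (𝓝 z) := by
  set q : ℕ → ℝ := fun n => ‖1 / 2 * (1 + (starRingEnd ℂ) z * w n)‖ with hqdef
  have hq1 : ∀ n, q n ≤ 1 := fun n => norm_half_le hz (hw n)
  have hlim : Tendsto q atTop (𝓝 1) := by
    refine tendsto_order.2 ⟨fun a ha => ?_, fun a ha => Eventually.of_forall fun n => (hq1 n).trans_lt ha⟩
    have ha' : max a 0 < 1 := max_lt ha one_pos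
    have h1 : Tendsto (fun n => (max a 0) ^ (N n)) atTop (𝓝 0) :=
      (tendsto_pow_atTop_nhds_zero_of_lt_one (le_max_right _ _) ha').comp hN
    filter_upwards [hq, h1.eventually (gt_mem_nhds hδ)] with n h2 h3
    by_contra! h4
    have h5 : q n ^ N n ≤ (max a 0) ^ N n :=
      pow_le_pow_left₀ (norm_nonneg _) (h4.trans (le_max_left _ _)) _
    have h2' : δ ≤ q n ^ N n := h2
    linarith
  have hid : ∀ n, ‖w n - z‖ ^ 2 = 4 - 4 * q n ^ 2 := by
    intro n
    set v := (starRingEnd ℂ) z * w n with hv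
    have hv1 : ‖v‖ = 1 := by simp [hv, hz, hw n]
    have hwv : w n - z = z * (v - 1) := by
      rw [hv, mul_sub, ← mul_assoc, mul_comm z, conj_mul_self_of_norm hz]; ring
    have h1 : ‖w n - z‖ = ‖v - 1‖ := by rw [hwv, norm_mul, hz, one_mul]
    have h2 : q n = 1 / 2 * ‖1 + v‖ := by
      simp only [hqdef]; rw [norm_mul]; norm_num [hv]
    have h3 := parallelogram_law_with_norm ℝ (1 : ℂ) v
    rw [hv1, norm_one] at h3
    rw [h1, h2, norm_sub_rev]
    nlinarith
  rw [tendsto_iff_norm_sub_tendsto_zero]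
  have h1 : Tendsto (fun n => ‖w n - z‖ ^ 2) atTop (𝓝 0) := by
    simp only [hid]
    have := (hlim.pow 2).const_mul 4 |>.const_sub 4
    simpa using this
  have h2 := (Real.continuous_sqrt.tendsto _).comp h1
  simpa [Function.comp_def, Real.sqrt_sq] using h2

end polys

section bundle5
variable {G X : Type*} [TopologicalSpace G] [TopologicalSpace X]
    [SecondCountableTopology G] [SecondCountableTopology X]
    [LocallyCompactSpace G] [LocallyCompactSpace X] [T2Space G] [T2Space X]
    [MeasurableSpace G] [BorelSpace G]
variable (B : AbelianGroupBundle G X) (β : X → Measure G) [hβ : Fact (IsHaarSystem B β)]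

lemma continuous_integral_norm (h0 : IsHaarSystem B β) (h : CC G) : Continuous fun x => ∫ s, ‖h s‖ ∂(β x) := by
  have h1 := h0.continuous_integral (fun s => ((‖h s‖ : ℝ) : ℂ))
    (Complex.continuous_ofReal.comp h.continuous.norm)
    (h.hasCompactSupport.comp_left (g := fun c : ℂ => ((‖c‖ : ℝ) : ℂ)) (by simp))
  have h2 := Complex.continuous_re.comp h1
  simpa only [Function.comp_def, integral_complex_ofReal, Complex.ofReal_re] using h2

/-- characters which are good approximations at level `N` -/
structure Good {x : X} (h : CC G) (κ δ : ℝ) (z : ℕ → ℂ) (t : ℕ → Fib B x) (E : Prop) (r : Fib B x)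
    (N : ℕ) (ω : Fib B x →* ℂ) : Prop where
  norm_one : ∀ t, ‖ω t‖ = 1
  le_DD : ∀ t : Fib B x, ‖ω t - 1‖ * κ ≤ DD B β h t
  le_peak : δ ≤ ‖MvPolynomial.eval (fun j => ω (t j)) (pk z N)‖
  far : E → δ ≤ ‖ω r - 1‖

lemma exists_good (h : CC G) {x : ℕ → X} {x₀ : X} (hx : Tendsto x atTop (𝓝 x₀))
    (t : ℕ → Fib B x₀) (tn : ∀ n, ℕ → Fib B (x n))
    (ht : ∀ j, Tendsto (fun n => (tn n j : G)) atTop (𝓝 (t j)))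
    (E : Set ℕ) (r : ∀ n, Fib B (x n))
    (hr : ∀ K : Set G, IsCompact K → ∀ᶠ n in atTop ⊓ 𝓟 E, (r n : G) ∉ K)
    (ω₀ : Fib B x₀ →* ℂ) (hω₀ : ∀ t, ‖ω₀ t‖ = 1) {κ₀ : ℝ} (hκ₀ : 0 < κ₀)
    (hop : ∀ b, ‖MonoidAlgebra.lift ℂ ℂ _ ω₀ b‖ * κ₀ ≤ ‖op B β x₀ h b‖) :
    ∃ δ > 0, ∀ N, ∀ᶠ n in atTop, ∃ ω : Fib B (x n) →* ℂ,
      Good B β h (κ₀ / 4) δ (fun j => ω₀ (t j)) (tn n) (n ∈ E) (r n) N ω := by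
  set M : ℝ := (∫ s, ‖h s‖ ∂(β x₀)) + 1 with hM
  have hM0 : 0 < M := by
    have : 0 ≤ ∫ s, ‖h s‖ ∂(β x₀) := integral_nonneg fun _ => norm_nonneg _
    linarith
  set z : ℕ → ℂ := fun j => ω₀ (t j) with hz
  have hz1 : ∀ j, ‖z j‖ = 1 := fun j => hω₀ _
  refine ⟨κ₀ / (4 * M), by positivity, fun N => ?_⟩
  have h0 : κ₀ / 2 < ‖op B β x₀ h (pe t (pk z N))‖ := by
    have h1 := hop (pe t (pk z N))
    rw [lift_pe, eval_pk_self z hz1, NormOneClass.norm_one, one_mul] at h1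
    linarith
  have hone : Tendsto (fun n => ((1 : Fib B (x n)) : G)) atTop (𝓝 (1 : Fib B x₀)) :=
    (B.continuous_unit.tendsto _).comp hx
  have hL : ∀ ξ η, Tendsto (fun n => Lam B β (x n) h ξ η (pe (tn n) (pk z N))) atTop
        (𝓝 (Lam B β x₀ h ξ η (pe t (pk z N)))) := by
    intro ξ η
    have := tendsto_Lam B β h ξ η t tn ht (pk z N) (fun n => 1) 1 hone
    simpa only [map_one, one_mul] using this
  have e1 : ∀ᶠ n in atTop, κ₀ / 2 < ‖op B β (x n) h (pe (tn n) (pk z N))‖ :=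
    lsc_norm B β hx le_rfl _ _ hL (by positivity) h0
  have e2 : ∀ᶠ n in atTop ⊓ 𝓟 E, κ₀ / 2 < ‖op B β (x n) h
      (MonoidAlgebra.of ℂ _ (r n) * pe (tn n) (pk z N) - pe (tn n) (pk z N))‖ := by
    have h0' : κ₀ / 2 < ‖op B β x₀ h (- pe t (pk z N))‖ := by
      have : op B β x₀ h (- pe t (pk z N)) = - op B β x₀ h (pe t (pk z N)) := by
        simp [op]
      rwa [this, norm_neg]
    refine lsc_norm B β hx inf_le_left _ _ (fun ξ η => ?_) (by positivity) h0'
    have h1 := (tendsto_Lam_escape B β h ξ η t tn (fun j => (ht j).mono_left inf_le_left) (pk z N) r hr).sub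
      ((hL ξ η).mono_left inf_le_left)
    have h2 : (0 : ℂ) - Lam B β x₀ h ξ η (pe t (pk z N)) = Lam B β x₀ h ξ η (- pe t (pk z N)) := by
      simp [Lam, op]
    rw [h2] at h1
    simp only [← Lam_sub] at h1
    exact h1
  rw [eventually_inf_principal] at e2
  have e3 : ∀ᶠ n in atTop, ∫ s, ‖h s‖ ∂(β (x n)) < M :=
    (((continuous_integral_norm B β hβ.out h).tendsto x₀).comp hx).eventually
      (gt_mem_nhds (show _ < M by rw [hM]; exact lt_add_one _))
  filter_upwards [e1, e2, e3] with n h1 h2 h3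
  by_cases hn : n ∈ E
  · obtain ⟨ω, κ, hκ, hω, hω1, hω2⟩ := exists_char B β h (x n)
      (MonoidAlgebra.of ℂ _ (r n) * pe (tn n) (pk z N) - pe (tn n) (pk z N))
    have h4 := h2 hn
    have hκM := (char_kappa_le B β h hω2).trans h3.le
    rw [hω1, map_sub, map_mul, MonoidAlgebra.lift_of, lift_pe, ← sub_one_mul, norm_mul] at h4
    set y := ‖MvPolynomial.eval (fun j => ω (tn n j)) (pk z N)‖ with hy
    have hy1 : y ≤ 1 := norm_eval_pk_le z _ hz1 (fun j => hω _) N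
    have hy0 : 0 ≤ y := norm_nonneg _
    set d := ‖ω (r n) - 1‖ with hd
    have hd0 : 0 ≤ d := norm_nonneg _
    have hd2 : d ≤ 2 := by
      refine (norm_sub_le _ _).trans ?_
      rw [hω, NormOneClass.norm_one]; norm_num
    have h5 : d * y * κ ≤ 2 * κ := by
      have : d * y ≤ 2 * 1 := by gcongr
      nlinarith
    refine ⟨ω, hω, fun t => ?_, ?_, fun _ => ?_⟩
    · refine le_trans ?_ (char_DD_le B β h hω2 t)
      gcongr
      linarith
    · rw [div_le_iff₀ (by positivity)]
      have : d * y * κ ≤ 2 * y * M := by gcongr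
      linarith
    · rw [div_le_iff₀ (by positivity)]
      have : d * y * κ ≤ d * 1 * M := by gcongr
      have : 0 ≤ d * M := by positivity
      linarith
  · obtain ⟨ω, κ, hκ, hω, hω1, hω2⟩ := exists_char B β h (x n) (pe (tn n) (pk z N))
    have h4 := h1
    have hκM := (char_kappa_le B β h hω2).trans h3.le
    rw [hω1, lift_pe] at h4
    set y := ‖MvPolynomial.eval (fun j => ω (tn n j)) (pk z N)‖ with hy
    have hy1 : y ≤ 1 := norm_eval_pk_le z _ hz1 (fun j => hω _) N
    have hy0 : 0 ≤ y := norm_nonneg _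
    refine ⟨ω, hω, fun t => ?_, ?_, fun h => absurd h hn⟩
    · refine le_trans ?_ (char_DD_le B β h hω2 t)
      gcongr
      nlinarith
    · rw [div_le_iff₀ (by positivity)]
      have : y * κ ≤ y * M := by gcongr
      have : 0 ≤ y * M := by positivity
      linarith

/-- a sequence of characters converging to a given one -/
lemma exists_char_seq (h : CC G) {x : ℕ → X} {x₀ : X} (hx : Tendsto x atTop (𝓝 x₀))
    (E : Set ℕ) (r : ∀ n, Fib B (x n))
    (hr : ∀ K : Set G, IsCompact K → ∀ᶠ n in atTop ⊓ 𝓟 E, (r n : G) ∉ K)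
    (ω₀ : Fib B x₀ →* ℂ) (hω₀ : ∀ t, ‖ω₀ t‖ = 1) {κ₀ : ℝ} (hκ₀ : 0 < κ₀)
    (hop : ∀ b, ‖MonoidAlgebra.lift ℂ ℂ _ ω₀ b‖ * κ₀ ≤ ‖op B β x₀ h b‖) :
    ∃ ω : ∀ n, Fib B (x n) →* ℂ, (∀ n, IsCharacter B (x n) (ω n)) ∧ IsCharacter B x₀ ω₀ ∧
      (∀ l ≤ (atTop : Filter ℕ), ∀ (s : ∀ n, Fib B (x n)) (s₀ : Fib B x₀),
        Tendsto (fun n => (s n : G)) l (𝓝 s₀) → Tendsto (fun n => ω n (s n)) l (𝓝 (ω₀ s₀))) ∧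
      ∃ δ > 0, ∀ᶠ n in atTop, n ∈ E → δ ≤ ‖ω n (r n) - 1‖ := by
  classical
  have : Nonempty (Fib B x₀) := ⟨1⟩
  set t : ℕ → Fib B x₀ := TopologicalSpace.denseSeq (Fib B x₀) with htdef
  have hdense : DenseRange t := TopologicalSpace.denseRange_denseSeq _
  choose tn' htn' using fun j => exists_lift B β hβ.out hx (t j)
  set tn : ∀ n, ℕ → Fib B (x n) := fun n j => tn' j n
  have htn : ∀ j, Tendsto (fun n => (tn n j : G)) atTop (𝓝 (t j)) := htn'
  obtain ⟨δ, hδ, hgood⟩ := exists_good B β h hx t tn htn E r hr ω₀ hω₀ hκ₀ hop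
  obtain ⟨N, hN, hNgood⟩ := exists_diag _ hgood
  have hsel : ∀ n, ∃ ω : Fib B (x n) →* ℂ, IsCharacter B (x n) ω ∧
      ((∃ ω : Fib B (x n) →* ℂ, Good B β h (κ₀ / 4) δ (fun j => ω₀ (t j)) (tn n) (n ∈ E) (r n) (N n) ω) →
        Good B β h (κ₀ / 4) δ (fun j => ω₀ (t j)) (tn n) (n ∈ E) (r n) (N n) ω) := by
    intro n
    by_cases hn : ∃ ω : Fib B (x n) →* ℂ,
        Good B β h (κ₀ / 4) δ (fun j => ω₀ (t j)) (tn n) (n ∈ E) (r n) (N n) ω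
    · obtain ⟨ω, hω⟩ := hn
      exact ⟨ω, isCharacter_of_DD B β h (by positivity) hω.norm_one hω.le_DD, fun _ => hω⟩
    · exact ⟨1, ⟨fun s => by simp, continuous_const, fun s t => by simp⟩, fun h => absurd h hn⟩
  choose ω hωc hωg using hsel
  have hG : ∀ᶠ n in atTop,
      Good B β h (κ₀ / 4) δ (fun j => ω₀ (t j)) (tn n) (n ∈ E) (r n) (N n) (ω n) := by
    filter_upwards [hNgood] with n hn using hωg n hn
  have hDD0 := fun t => char_DD_le B β h hop t
  have hj : ∀ j, Tendsto (fun n => ω n (tn n j)) atTop (𝓝 (ω₀ (t j))) := by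
    intro j
    refine tendsto_of_peak (hω₀ _) (fun n => (hωc n).norm_one _) hN hδ ?_
    filter_upwards [hG, hN.eventually_gt_atTop j] with n h1 h2
    exact h1.le_peak.trans (norm_eval_pk_le_pow (fun j => ω₀ (t j)) (fun j => ω n (tn n j))
      (fun j => hω₀ _) (fun j => h1.norm_one _) h2)
  refine ⟨ω, hωc, isCharacter_of_DD B β h hκ₀ hω₀ hDD0, ?_, δ, hδ, ?_⟩
  · intro l hl s s₀ hs
    rw [Metric.tendsto_nhds]
    intro ε hε
    have hκ4 : 0 < κ₀ / 4 := by positivity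
    have hsub : ∀ {Γ : Type _} [CommGroup Γ] (χ : Γ →* ℂ) (_ : ∀ t, ‖χ t‖ = 1) (a b : Γ),
        ‖χ (a⁻¹ * b) - 1‖ = ‖χ b - χ a‖ := by
      intro Γ _ χ hχ a b
      have : χ b - χ a = χ a * (χ (a⁻¹ * b) - 1) := by
        rw [mul_sub, ← map_mul, mul_inv_cancel_left, mul_one]
      rw [this, norm_mul, hχ, one_mul]
    obtain ⟨j, hjε⟩ : ∃ j, DD B β h ((t j)⁻¹ * s₀ : Fib B x₀) < ε / 3 * (κ₀ / 4) := by
      have hO : IsOpen {a : Fib B x₀ | DD B β h (a⁻¹ * s₀ : Fib B x₀) < ε / 3 * (κ₀ / 4)} := by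
        refine isOpen_lt ((continuous_DD B β h).comp (continuous_subtype_val.comp ?_)) continuous_const
        exact continuous_inv.mul continuous_const
      obtain ⟨j, hj⟩ := hdense.exists_mem_open hO ⟨s₀, by
        rw [Set.mem_ofPred_eq, inv_mul_cancel, DD_one]; positivity⟩
      exact ⟨j, hj⟩
    have h1 : Tendsto (fun n => DD B β h ((tn n j)⁻¹ * s n : Fib B (x n))) l
        (𝓝 (DD B β h ((t j)⁻¹ * s₀ : Fib B x₀))) :=
      ((continuous_DD B β h).tendsto _).comp
        (tendsto_fib_mul B (tendsto_fib_inv B ((htn j).mono_left hl)) hs)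
    have h2 := (Metric.tendsto_nhds.1 (hj j) (ε / 3) (by positivity))
    filter_upwards [h1.eventually (gt_mem_nhds hjε), hl h2, hl hG] with n k1 k2 k3
    have k4 : ‖ω n (s n) - ω n (tn n j)‖ < ε / 3 := by
      rw [← hsub (ω n) k3.norm_one]
      exact lt_of_mul_lt_mul_right ((k3.le_DD _).trans_lt k1) hκ4.le
    have k5 : ‖ω₀ s₀ - ω₀ (t j)‖ < ε / 3 := by
      rw [← hsub ω₀ hω₀]
      refine lt_of_mul_lt_mul_right (lt_of_le_of_lt ?_ hjε) hκ4.le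
      refine le_trans ?_ (hDD0 _)
      gcongr
      linarith
    rw [← dist_eq_norm] at k4 k5
    rw [dist_comm] at k5
    have := dist_triangle4 (ω n (s n)) (ω n (tn n j)) (ω₀ (t j)) (ω₀ s₀)
    linarith
  · filter_upwards [hG] with n hn using hn.far

end bundle5

open Filter Topology MeasureTheory
set_option linter.unusedSectionVars false

section bundle6
variable {G X : Type*} [TopologicalSpace G] [TopologicalSpace X]
    [SecondCountableTopology G] [SecondCountableTopology X]
    [LocallyCompactSpace G] [LocallyCompactSpace X] [T2Space G] [T2Space X]
    [MeasurableSpace G] [BorelSpace G]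
variable (B : AbelianGroupBundle G X) (β : X → Measure G) [hβ : Fact (IsHaarSystem B β)]

lemma exists_cv_ne (x : X) (T : Lp ℂ 2 (fm B β x) →L[ℂ] Lp ℂ 2 (fm B β x)) (hT : T ≠ 0) :
    ∃ h : CC G, T * cv B β x h ≠ 0 := by
  obtain ⟨O, hO, H⟩ := exists_mul_conv_ne (fm B β x) T hT
  obtain ⟨O', hO', hsub⟩ := (mem_nhds_subtype _ _ _).1 hO
  obtain ⟨f, hf1, hf2, hf3, hf4⟩ := exists_bump hO'
  have hcs : HasCompactSupport fun s => (f s : ℂ) :=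
    hf1.comp_left (g := fun x : ℝ => (x : ℂ)) (by simp)
  let h : CC G := ⟨⟨fun s => (f s : ℂ), Complex.continuous_ofReal.comp f.continuous⟩, hcs⟩
  refine ⟨h, H (fun s => f s.1) (cont_res B h x) (supp_res B h x) (fun s => hf2 _) ?_ fun s hs => ?_⟩
  · rw [hf3]; exact one_pos
  · exact hf4 _ fun hs' => hs (hsub hs')

lemma exists_char₀ (x : X) (a : MonoidAlgebra ℂ (Fib B x))
    (ha : MonoidAlgebra.lift ℂ (Lp ℂ 2 (fm B β x) →L[ℂ] Lp ℂ 2 (fm B β x)) (Fib B x)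
      (transl (fm B β x)) a ≠ 0) :
    ∃ (h : CC G) (ω : Fib B x →* ℂ) (κ : ℝ), 0 < κ ∧ (∀ t, ‖ω t‖ = 1) ∧
      MonoidAlgebra.lift ℂ ℂ _ ω a ≠ 0 ∧
      ∀ b, ‖MonoidAlgebra.lift ℂ ℂ _ ω b‖ * κ ≤ ‖op B β x h b‖ := by
  obtain ⟨h, hh⟩ := exists_cv_ne B β x _ ha
  obtain ⟨ω, κ, hκ, hω, h1, h2⟩ := exists_char B β h x a
  have h3 : ‖op B β x h a‖ ≠ 0 := norm_ne_zero_iff.2 hh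
  rw [h1] at h3
  exact ⟨h, ω, κ, lt_of_le_of_ne hκ (Ne.symm (right_ne_zero_of_mul h3)), hω,
    norm_ne_zero_iff.1 (left_ne_zero_of_mul h3), h2⟩

lemma tendsto_unit_of_char (h0 : IsHaarSystem B β) {x : ℕ → X} {x₀ : X} (hx : Tendsto x atTop (𝓝 x₀)) (r : ∀ n, Fib B (x n))
    (H : ∀ (ω : ∀ n, Fib B (x n) →* ℂ) (ω₀ : Fib B x₀ →* ℂ), (∀ n, IsCharacter B (x n) (ω n)) →
      IsCharacter B x₀ ω₀ → CharTendsto B x (fun n => ω n) x₀ ω₀ →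
      Tendsto (fun n => ω n (r n)) atTop (𝓝 1)) :
    Tendsto (fun n => (r n : G)) atTop (𝓝 (B.unit x₀)) := by
  have hβ : Fact (IsHaarSystem B β) := ⟨h0⟩
  by_contra hnot
  rw [not_tendsto_iff_exists_frequently_notMem] at hnot
  obtain ⟨O, hO, hfreq⟩ := hnot
  set E : Set ℕ := {n | (r n : G) ∉ O} with hE
  have hbot : (atTop ⊓ 𝓟 E).NeBot := frequently_mem_iff_neBot.1 hfreq
  by_cases hesc : ∀ K : Set G, IsCompact K → ∀ᶠ n in atTop ⊓ 𝓟 E, (r n : G) ∉ K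
  · have hne : (1 : Lp ℂ 2 (fm B β x₀) →L[ℂ] Lp ℂ 2 (fm B β x₀)) ≠ 0 := by
      obtain ⟨f, hf1, hf2, hf3, hf4⟩ := exists_bump (univ_mem : Set.univ ∈ 𝓝 (B.unit x₀))
      have hcs : HasCompactSupport fun s => (f s : ℂ) :=
        hf1.comp_left (g := fun x : ℝ => (x : ℂ)) (by simp)
      let h : CC G := ⟨⟨fun s => (f s : ℂ), Complex.continuous_ofReal.comp f.continuous⟩, hcs⟩
      intro h10
      have h0 : lf B β x₀ h = 0 := by
        have := DFunLike.congr_fun h10 (lf B β x₀ h)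
        simpa using this
      have h00 : (fun s : Fib B x₀ => h s.1) =ᵐ[fm B β x₀] fun _ => 0 := by
        have k1 := (memLp_res B β h x₀).coeFn_toLp
        have k2 : (memLp_res B β h x₀).toLp _ = 0 := h0
        rw [k2] at k1
        exact k1.symm.trans (Lp.coeFn_zero _ _ _)
      have h1 := Continuous.ae_eq_iff_eq (fm B β x₀) (cont_res B h x₀) continuous_const |>.1 h00
      have h2 := congrFun h1 (1 : Fib B x₀)
      have h3 : (f (B.unit x₀) : ℂ) = 0 := h2
      rw [hf3] at h3
      simp at h3
    obtain ⟨h, ω₀, κ₀, hκ₀, hω₀, -, hop⟩ := exists_char₀ B β x₀ 1 (by rwa [map_one])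
    obtain ⟨ω, hωc, hω₀c, hlim, δ, hδ, hfar⟩ := exists_char_seq B β h hx E r hesc ω₀ hω₀ hκ₀ hop
    have h1 := H ω ω₀ hωc hω₀c ⟨hx, fun s s₀ hs hs₀ hss =>
      hlim atTop le_rfl (fun n => ⟨s n, hs n⟩) ⟨s₀, hs₀⟩ hss⟩
    rw [tendsto_iff_norm_sub_tendsto_zero] at h1
    obtain ⟨n, hn1, hn2, hn3⟩ := (hfreq.and_eventually
      (hfar.and (h1.eventually (gt_mem_nhds hδ)))).exists
    exact absurd (hn2 hn1) (not_le.2 hn3)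
  · push Not at hesc
    obtain ⟨K, hK, hKf⟩ := hesc
    have hKf' : ∃ᶠ n in atTop ⊓ 𝓟 E, n ∈ {n | (r n : G) ∈ K} := by
      refine fun hh => hKf (hh.mono fun n hn => hn)
    have hbot' := frequently_mem_iff_neBot.1 hKf'
    set l' := atTop ⊓ 𝓟 E ⊓ 𝓟 {n | (r n : G) ∈ K} with hl'
    have hle : map (fun n => (r n : G)) l' ≤ 𝓟 K := by
      rw [le_principal_iff, mem_map]
      exact mem_inf_of_right (mem_principal_self _)
    obtain ⟨r₀, hr₀K, hcl⟩ := hK hle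
    have hlbot : (l' ⊓ comap (fun n => (r n : G)) (𝓝 r₀)).NeBot := by
      rw [← map_neBot_iff (fun n => (r n : G)), Filter.push_pull, inf_comm]
      exact hcl
    set l := l' ⊓ comap (fun n => (r n : G)) (𝓝 r₀) with hl
    have hlt : l ≤ atTop := inf_le_left.trans (inf_le_left.trans inf_le_left)
    have hrl : Tendsto (fun n => (r n : G)) l (𝓝 r₀) := tendsto_comap.mono_left inf_le_right
    have hpr : B.p r₀ = x₀ := by
      have h1 : Tendsto (fun n => B.p (r n)) l (𝓝 (B.p r₀)) := (B.continuous_p.tendsto _).comp hrl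
      have h2 : (fun n => B.p (r n)) = x := funext fun n => (r n).2
      rw [h2] at h1
      exact tendsto_nhds_unique h1 (hx.mono_left hlt)
    have hr1 : (⟨r₀, hpr⟩ : Fib B x₀) ≠ 1 := by
      intro h1
      have h2 : r₀ = B.unit x₀ := congrArg Subtype.val h1
      rw [h2] at hrl
      have h3 : ∀ᶠ n in l, (r n : G) ∉ O := by
        have : l ≤ 𝓟 E := inf_le_left.trans (inf_le_left.trans inf_le_right)
        exact this (mem_principal_self _)
      obtain ⟨n, hn1, hn2⟩ := (h3.and (hrl.eventually hO)).exists
      exact hn1 hn2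
    obtain ⟨h, ω₀, κ₀, hκ₀, hω₀, hne, hop⟩ := exists_char₀ B β x₀
      (MonoidAlgebra.of ℂ _ (⟨r₀, hpr⟩ : Fib B x₀) - 1) (by
        rw [map_sub, map_one, MonoidAlgebra.lift_of]
        exact sub_ne_zero.2 (transl_ne_one (fm B β x₀) _ hr1))
    rw [map_sub, map_one, MonoidAlgebra.lift_of, sub_ne_zero] at hne
    obtain ⟨ω, hωc, hω₀c, hlim, -⟩ := exists_char_seq B β h hx ∅ r (by simp) ω₀ hω₀ hκ₀ hop
    have h1 := H ω ω₀ hωc hω₀c ⟨hx, fun s s₀ hs hs₀ hss =>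
      hlim atTop le_rfl (fun n => ⟨s n, hs n⟩) ⟨s₀, hs₀⟩ hss⟩
    exact hne (tendsto_nhds_unique (hlim l hlt r ⟨r₀, hpr⟩ hrl) (h1.mono_left hlt))

end bundle6

theorem abelianGroupBundle_tendsto_iff_doubleDual
    {G X : Type*} [TopologicalSpace G] [TopologicalSpace X]
    [SecondCountableTopology G] [SecondCountableTopology X]
    [LocallyCompactSpace G] [LocallyCompactSpace X] [T2Space G] [T2Space X]
    [MeasurableSpace G] [BorelSpace G]
    (B : AbelianGroupBundle G X) (β : X → Measure G) (hβ : IsHaarSystem B β)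
    (s : ℕ → G) (s₀ : G) :
    Tendsto s atTop (𝓝 s₀) ↔
      (Tendsto (fun n => B.p (s n)) atTop (𝓝 (B.p s₀)) ∧
        ∀ (ω : ∀ n, {t : G // B.p t = B.p (s n)} → ℂ)
          (ω₀ : {t : G // B.p t = B.p s₀} → ℂ),
          (∀ n, IsCharacter B (B.p (s n)) (ω n)) →
          IsCharacter B (B.p s₀) ω₀ →
          CharTendsto B (fun n => B.p (s n)) ω (B.p s₀) ω₀ →
          Tendsto (fun n => ω n ⟨s n, rfl⟩) atTop (𝓝 (ω₀ ⟨s₀, rfl⟩))) := by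
  constructor
  · intro hs
    exact ⟨(B.continuous_p.tendsto _).comp hs, fun ω ω₀ _ _ h => h.2 s s₀ (fun n => rfl) rfl hs⟩
  · rintro ⟨hx, H⟩
    have hfact : Fact (IsHaarSystem B β) := ⟨hβ⟩
    obtain ⟨t, ht⟩ := exists_lift B β hβ hx (⟨s₀, rfl⟩ : Fib B (B.p s₀))
    set σ : ∀ n, Fib B (B.p (s n)) := fun n => ⟨s n, rfl⟩ with hσ
    have key := tendsto_unit_of_char B β hβ hx (fun n => σ n * (t n)⁻¹) (by
      intro ω ω₀ hω hω₀ hc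
      have h1 := H (fun n => ω n) ω₀ hω hω₀ hc
      have h2 := hc.2 (fun n => (t n : G)) s₀ (fun n => (t n).2) rfl ht
      have hne : ω₀ ⟨s₀, rfl⟩ ≠ 0 := norm_ne_zero_iff.1 (by rw [hω₀.norm_one]; exact one_ne_zero)
      have h3 := h1.div h2 hne
      rw [div_self hne] at h3
      refine h3.congr fun n => ?_
      have hn : ω n (t n) ≠ 0 := norm_ne_zero_iff.1 (by rw [(hω n).norm_one]; exact one_ne_zero)
      refine (eq_div_of_mul_eq hn ?_).symm
      rw [← map_mul, inv_mul_cancel_right])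
    have h4 := tendsto_fib_mul B (x := fun n => B.p (s n)) (a₀ := (1 : Fib B (B.p s₀))) key ht
    simpa [hσ] using h4
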